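/- Let p be an odd prime and let K be a finite extension of the p-adic field Q_p. If F is a function field in one variable over K, then u(F) = 8. -/

import Mathlib

open scoped ENNReal

/-!
Statement 5 (Corollary 4.15, first proved by Parimala–Suresh): if `p` is an odd prime,
`K` is a finite extension of `ℚ_p`, and `F` is a function field in one variable over
`K`, then `u(F) = 8`.
-/

/-- The `u`-invariant of a field (stated for a commutative ring) `k`:
the supremum in `ℕ∞` of the dimensions of anisotropic quadratic forms over `k`. -/
noncomputable def uInv (k : Type) [CommRing k] : ℕ∞ :=
  sSup {n : ℕ∞ | ∃ m : ℕ, n = m ∧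
    ∃ Q : QuadraticForm k (Fin m → k), Q.Anisotropic}

/-- `E` is a finitely generated field extension of `k` of transcendence degree one. -/
def IsOneVarFunctionField (k E : Type) [Field k] [Field E] [Algebra k E] : Prop :=
  ∃ x : E, Transcendental k x ∧
    FiniteDimensional (IntermediateField.adjoin k {x}) E

/-- There is an anisotropic diagonal quadratic form over `k` with coefficients indexed by `ι`. -/
def HasAnisotropicDiagonal (k : Type) [CommRing k] (ι : Type) [Fintype ι] : Prop :=
  ∃ a : ι → k, ∀ x : ι → k, ∑ i, a i * x i ^ 2 = 0 → x = 0

theorem eq_zero_of_forall_pow_dvd {R : Type*} [CommRing R] [IsDomain R] [IsNoetherianRing R]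
    {π : R} (hπ : ¬ IsUnit π) {x : R} (h : ∀ k : ℕ, π ^ k ∣ x) : x = 0 := by
  by_contra hx
  have hf : FiniteMultiplicity π x := FiniteMultiplicity.of_not_isUnit hπ hx
  exact hf.not_pow_dvd_of_multiplicity_lt (Nat.lt_succ_self _) (h _)

theorem HasAnisotropicDiagonal.of_residue {R E κ : Type} [CommRing R] [IsDomain R]
    [IsDiscreteValuationRing R] [Field E] [Algebra R E] [IsFractionRing R E] [Field κ]
    (φ : R →+* κ) (hφ : Function.Surjective φ) {ι : Type} [Fintype ι]
    (h : HasAnisotropicDiagonal κ ι) : HasAnisotropicDiagonal E (ι ⊕ ι) := by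
  obtain ⟨a, ha⟩ := h
  choose b hb using fun i => hφ (a i)
  obtain ⟨π, hπ⟩ := IsDiscreteValuationRing.exists_irreducible R
  have hπ0 : π ≠ 0 := hπ.ne_zero
  have hker : ∀ x, φ x = 0 ↔ π ∣ x := by
    intro x
    have hm : RingHom.ker φ = IsLocalRing.maximalIdeal R :=
      IsLocalRing.eq_maximalIdeal (RingHom.ker_isMaximal_of_surjective φ hφ)
    rw [← RingHom.mem_ker, hm, hπ.maximalIdeal_eq, Ideal.mem_span_singleton]
  have key : ∀ x : ι → R, π ∣ ∑ i, b i * x i ^ 2 → ∀ i, π ∣ x i := by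
    intro x hx i
    rw [← hker] at hx ⊢
    have := ha (fun i => φ (x i)) (by simpa [hb] using hx)
    exact congrFun this i
  have desc : ∀ x y : ι → R, ∑ i, b i * x i ^ 2 + π * ∑ i, b i * y i ^ 2 = 0 →
      ∃ x' y' : ι → R, (∀ i, x i = π * x' i) ∧ (∀ i, y i = π * y' i) ∧
        ∑ i, b i * x' i ^ 2 + π * ∑ i, b i * y' i ^ 2 = 0 := by
    intro x y hxy
    have h1 : ∀ i, π ∣ x i := key x (by
      rw [eq_neg_of_add_eq_zero_left hxy]; exact (dvd_mul_right _ _).neg_right)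
    choose x' hx' using h1
    have h2 : π * ∑ i, b i * x' i ^ 2 + ∑ i, b i * y i ^ 2 = 0 := by
      have : π * (π * ∑ i, b i * x' i ^ 2 + ∑ i, b i * y i ^ 2) = 0 := by
        rw [← hxy, mul_add, Finset.mul_sum, Finset.mul_sum]
        congr 1
        refine Finset.sum_congr rfl fun i _ => ?_
        rw [hx']; ring
      exact (mul_eq_zero.mp this).resolve_left hπ0
    have h3 : ∀ i, π ∣ y i := key y (by
      rw [eq_neg_of_add_eq_zero_right h2]; exact (dvd_mul_right _ _).neg_right)
    choose y' hy' using h3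
    refine ⟨x', y', hx', hy', ?_⟩
    have : π * (∑ i, b i * x' i ^ 2 + π * ∑ i, b i * y' i ^ 2) = 0 := by
      rw [← h2, mul_add, Finset.mul_sum, Finset.mul_sum, Finset.mul_sum]
      congr 1
      refine Finset.sum_congr rfl fun i _ => ?_
      rw [hy']; ring
    exact (mul_eq_zero.mp this).resolve_left hπ0
  have all : ∀ k : ℕ, ∀ x y : ι → R, ∑ i, b i * x i ^ 2 + π * ∑ i, b i * y i ^ 2 = 0 →
      (∀ i, π ^ k ∣ x i) ∧ ∀ i, π ^ k ∣ y i := by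
    intro k
    induction k with
    | zero => simp
    | succ k ih =>
      intro x y hxy
      obtain ⟨x', y', hx, hy, h⟩ := desc x y hxy
      obtain ⟨h1, h2⟩ := ih x' y' h
      refine ⟨fun i => ?_, fun i => ?_⟩
      · rw [hx, pow_succ']; exact mul_dvd_mul_left _ (h1 i)
      · rw [hy, pow_succ']; exact mul_dvd_mul_left _ (h2 i)
  refine ⟨Sum.elim (fun i => algebraMap R E (b i)) fun i => algebraMap R E (π * b i), ?_⟩
  intro z hz
  obtain ⟨d, hd⟩ := IsLocalization.exist_integer_multiples_of_finite (nonZeroDivisors R) z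
  choose w hw using hd
  have hd0 : algebraMap R E d ≠ 0 :=
    IsFractionRing.to_map_ne_zero_of_mem_nonZeroDivisors d.2
  have hw' : ∀ i, algebraMap R E (w i) = algebraMap R E d * z i := fun i => by
    rw [hw, Algebra.smul_def]
  have hsum : ∑ i, b i * w (Sum.inl i) ^ 2 + π * ∑ i, b i * w (Sum.inr i) ^ 2 = 0 := by
    apply IsFractionRing.injective R E
    rw [map_zero, ← mul_zero (algebraMap R E d ^ 2), ← hz, Fintype.sum_sum_type]
    simp only [map_add, map_sum, map_mul, map_pow, hw', Sum.elim_inl, Sum.elim_inr, mul_add,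
      Finset.mul_sum]
    congr 1 <;> refine Finset.sum_congr rfl fun i _ => ?_ <;> ring
  have hw0 : ∀ i, w i = 0 := by
    intro i
    refine eq_zero_of_forall_pow_dvd hπ.not_isUnit fun k => ?_
    rcases i with i | i
    · exact (all k _ _ hsum).1 i
    · exact (all k _ _ hsum).2 i
  funext i
  have := hw' i
  rw [hw0, map_zero, eq_comm, mul_eq_zero] at this
  exact this.resolve_left hd0

theorem HasAnisotropicDiagonal.of_finiteField {κ : Type} [Field κ] [Finite κ]
    (h2 : ringChar κ ≠ 2) : HasAnisotropicDiagonal κ (Fin 2) := by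
  obtain ⟨u, hu⟩ := FiniteField.exists_nonsquare h2
  refine ⟨![1, -u], fun x hx => ?_⟩
  rw [Fin.sum_univ_two] at hx
  simp only [Matrix.cons_val_zero, Matrix.cons_val_one, one_mul] at hx
  have h1 : x 1 = 0 := by
    by_contra h
    apply hu
    refine ⟨x 0 / x 1, ?_⟩
    field_simp
    linear_combination -hx
  have h0 : x 0 = 0 := by
    rw [h1] at hx
    simpa using hx
  funext i
  fin_cases i <;> simp [h0, h1]

/-- A place of a finite separable extension `L` of the fraction field of a Dedekind domain `A`
above a nonzero maximal ideal of `A`. -/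
theorem exists_residue_extension (A E L k : Type) [CommRing A] [IsDedekindDomain A]
    [Field E] [Algebra A E] [IsFractionRing A E] [Field L] [Algebra E L] [Algebra A L]
    [IsScalarTower A E L] [FiniteDimensional E L] [Algebra.IsSeparable E L]
    [Field k] [Algebra A k] (hk : Function.Surjective (algebraMap A k))
    (hk0 : ∃ a : A, a ≠ 0 ∧ algebraMap A k a = 0) :
    ∃ (κ : Type) (_ : Field κ) (_ : Algebra k κ), FiniteDimensional k κ ∧
      ∀ (ι : Type) [Fintype ι], HasAnisotropicDiagonal κ ι → HasAnisotropicDiagonal L (ι ⊕ ι) := by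
  let B := integralClosure A L
  have : IsDedekindDomain B := integralClosure.isDedekindDomain A E L
  have : IsFractionRing B L := integralClosure.isFractionRing_of_finite_extension E L
  have : Module.Finite A B := IsIntegralClosure.finite A E L B
  have hAL : Function.Injective (algebraMap A L) := by
    rw [IsScalarTower.algebraMap_eq A E L]
    exact (algebraMap E L).injective.comp (IsFractionRing.injective A E)
  have hAB : Function.Injective (algebraMap A B) := by
    rw [IsScalarTower.algebraMap_eq A B L, RingHom.coe_comp] at hAL
    exact hAL.of_comp
  let m : Ideal A := RingHom.ker (algebraMap A k)
  have hm : m.IsMaximal := RingHom.ker_isMaximal_of_surjective _ hk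
  obtain ⟨P, hP, hPm⟩ := Ideal.exists_ideal_over_maximal_of_isIntegral (S := B) m
    (by rw [(RingHom.injective_iff_ker_eq_bot _).mp hAB]
        exact bot_le)
  have hP0 : P ≠ ⊥ := by
    rintro rfl
    obtain ⟨a, ha0, ha⟩ := hk0
    have : a ∈ Ideal.comap (algebraMap A B) ⊥ := by rw [hPm]; exact ha
    rw [Ideal.mem_comap, Ideal.mem_bot] at this
    exact ha0 (hAB (by rw [this, map_zero]))
  let R := Localization.AtPrime P
  have : IsDiscreteValuationRing R :=
    IsLocalization.AtPrime.isDiscreteValuationRing_of_dedekind_domain B hP0 R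
  let : Algebra R L := IsLocalization.localizationAlgebraOfSubmonoidLe R L P.primeCompl
    (nonZeroDivisors B) P.primeCompl_le_nonZeroDivisors
  have : IsScalarTower B R L := IsLocalization.localization_isScalarTower_of_submonoid_le R L
    P.primeCompl (nonZeroDivisors B) P.primeCompl_le_nonZeroDivisors
  have : IsFractionRing R L :=
    IsFractionRing.isFractionRing_of_isDomain_of_isLocalization P.primeCompl R L
  let : Field (B ⧸ P) := Ideal.Quotient.field P
  let φ : R →+* B ⧸ P := (IsLocalization.AtPrime.equivQuotMaximalIdeal P R).symm.toRingHom.comp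
    (Ideal.Quotient.mk _)
  have hφ : Function.Surjective φ :=
    (IsLocalization.AtPrime.equivQuotMaximalIdeal P R).symm.surjective.comp
      Ideal.Quotient.mk_surjective
  let e : k ≃+* A ⧸ m := (RingHom.quotientKerEquivOfSurjective hk).symm
  let g : k →+* B ⧸ P := (Ideal.quotientMap P (algebraMap A B) hPm.ge).comp e.toRingHom
  let : Algebra k (B ⧸ P) := g.toAlgebra
  have he : ∀ a : A, e (algebraMap A k a) = Ideal.Quotient.mk m a := fun a => by
    rw [RingEquiv.symm_apply_eq]; rfl
  have : IsScalarTower A k (B ⧸ P) := by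
    refine IsScalarTower.of_algebraMap_eq fun a => ?_
    change _ = (Ideal.quotientMap P (algebraMap A B) hPm.ge) (e (algebraMap A k a))
    rw [he, Ideal.quotientMap_mk]
    rfl
  have : Module.Finite A (B ⧸ P) := Module.Finite.of_surjective
    ((Ideal.Quotient.mkₐ A P).toLinearMap) Ideal.Quotient.mk_surjective
  exact ⟨B ⧸ P, inferInstance, inferInstance, Module.Finite.of_restrictScalars_finite A k (B ⧸ P),
    fun ι _ h => h.of_residue φ hφ⟩

theorem hasAnisotropicDiagonal_of_finite_padic (p : ℕ) [Fact p.Prime] (hp : p ≠ 2)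
    (K : Type) [Field K] [Algebra ℚ_[p] K] [FiniteDimensional ℚ_[p] K] :
    HasAnisotropicDiagonal K (Fin 2 ⊕ Fin 2) := by
  let : Algebra ℤ_[p] K := ((algebraMap ℚ_[p] K).comp (algebraMap ℤ_[p] ℚ_[p])).toAlgebra
  have : IsScalarTower ℤ_[p] ℚ_[p] K := IsScalarTower.of_algebraMap_eq fun _ => rfl
  let : Algebra ℤ_[p] (ZMod p) := PadicInt.toZMod.toAlgebra
  have hs : Function.Surjective (algebraMap ℤ_[p] (ZMod p)) := ZMod.ringHom_surjective _
  obtain ⟨κ, _, _, hfin, h⟩ := exists_residue_extension ℤ_[p] ℚ_[p] K (ZMod p) hs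
    ⟨p, by exact_mod_cast (Fact.out : p.Prime).ne_zero, by simp⟩
  have : Finite κ := Module.finite_of_finite (ZMod p)
  have : CharP κ p := charP_of_injective_algebraMap (algebraMap (ZMod p) κ).injective p
  exact h _ (HasAnisotropicDiagonal.of_finiteField (by rw [ringChar.eq κ p]; exact hp))

theorem hasAnisotropicDiagonal_of_functionField (p : ℕ) [Fact p.Prime] (hp : p ≠ 2)
    (K : Type) [Field K] [Algebra ℚ_[p] K] [FiniteDimensional ℚ_[p] K]
    (E F : Type) [Field E] [Algebra (Polynomial K) E] [IsFractionRing (Polynomial K) E]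
    [Field F] [Algebra E F] [FiniteDimensional E F] :
    HasAnisotropicDiagonal F ((Fin 2 ⊕ Fin 2) ⊕ (Fin 2 ⊕ Fin 2)) := by
  let : Algebra (Polynomial K) F :=
    ((algebraMap E F).comp (algebraMap (Polynomial K) E)).toAlgebra
  have : IsScalarTower (Polynomial K) E F := IsScalarTower.of_algebraMap_eq fun _ => rfl
  have : CharZero K := charZero_of_injective_algebraMap (algebraMap ℚ_[p] K).injective
  have : CharZero E := charZero_of_injective_algebraMap (IsFractionRing.injective (Polynomial K) E)
  let : Algebra (Polynomial K) K := (Polynomial.evalRingHom 0).toAlgebra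
  have hev : ∀ f, algebraMap (Polynomial K) K f = f.eval 0 := fun _ => rfl
  have : IsScalarTower K (Polynomial K) K := IsScalarTower.of_algebraMap_eq fun x => by
    simp [hev]
  obtain ⟨κ, _, _, hfin, h⟩ := exists_residue_extension (Polynomial K) E F K
    (fun x => ⟨Polynomial.C x, by simp [hev]⟩) ⟨Polynomial.X, Polynomial.X_ne_zero, by simp [hev]⟩
  let : Algebra ℚ_[p] κ := ((algebraMap K κ).comp (algebraMap ℚ_[p] K)).toAlgebra
  have : IsScalarTower ℚ_[p] K κ := IsScalarTower.of_algebraMap_eq fun _ => rfl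
  have : FiniteDimensional ℚ_[p] κ := FiniteDimensional.trans ℚ_[p] K κ
  exact h _ (hasAnisotropicDiagonal_of_finite_padic p hp κ)

open Polynomial in
/-- Springer's theorem in terms of polynomials: an anisotropic quadratic form stays anisotropic
modulo an irreducible polynomial of odd degree. -/
theorem springer_odd_degree {F : Type*} [Field F] {ι : Type*} [Fintype ι] (q : ι → ι → F)
    (hq : ∀ x : ι → F, ∑ i, ∑ j, q i j * (x i * x j) = 0 → x = 0)
    (f : F[X]) (hf : Irreducible f) (hodd : Odd f.natDegree) (g : ι → F[X])
    (hdvd : f ∣ ∑ i, ∑ j, C (q i j) * (g i * g j)) : ∀ i, f ∣ g i := by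
  classical
  induction hn : f.natDegree using Nat.strong_induction_on generalizing f g with
  | _ n ih =>
  by_contra hcon
  push Not at hcon
  obtain ⟨i₀, hi₀⟩ := hcon
  -- reduce modulo `f`
  let g₁ : ι → F[X] := fun i => g i % f
  have hg₁ : ∀ i, f ∣ g i - g₁ i := fun i => ⟨g i / f, by
    have := EuclideanDomain.div_add_mod (g i) f
    simp only [g₁]
    linear_combination -this⟩
  have hg₁0 : g₁ i₀ ≠ 0 := fun h => hi₀ (by have := hg₁ i₀; rwa [h, sub_zero] at this)
  have hg₁d : ∀ i, (g₁ i).degree < f.degree := fun i => EuclideanDomain.mod_lt _ hf.ne_zero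
  have hdvd₁ : f ∣ ∑ i, ∑ j, C (q i j) * (g₁ i * g₁ j) := by
    have : f ∣ ∑ i, ∑ j, C (q i j) * (g i * g j) - ∑ i, ∑ j, C (q i j) * (g₁ i * g₁ j) := by
      rw [← Finset.sum_sub_distrib]
      refine Finset.dvd_sum fun i _ => ?_
      rw [← Finset.sum_sub_distrib]
      refine Finset.dvd_sum fun j _ => ?_
      have : C (q i j) * (g i * g j) - C (q i j) * (g₁ i * g₁ j) =
          (g i - g₁ i) * (C (q i j) * g j) + (g j - g₁ j) * (C (q i j) * g₁ i) := by ring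
      rw [this]
      exact dvd_add ((hg₁ i).mul_right _) ((hg₁ j).mul_right _)
    exact (dvd_sub_right hdvd).mp this
  -- divide by the greatest common divisor
  obtain ⟨e, he⟩ : ∃ e, e = Finset.univ.gcd g₁ := ⟨_, rfl⟩
  obtain ⟨g₂, hg₂, hgcd⟩ := Finset.extract_gcd g₁ ⟨i₀, Finset.mem_univ i₀⟩
  rw [← he] at hg₂
  have he0 : e ≠ 0 := fun h => hg₁0 (by rw [hg₂ _ (Finset.mem_univ _), h, zero_mul])
  have hg₂' : ∀ i, g₁ i = e * g₂ i := fun i => hg₂ i (Finset.mem_univ i)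
  have hg₂d : ∀ i, (g₂ i).degree < f.degree := fun i => by
    by_cases h : g₂ i = 0
    · rw [h, degree_zero]; exact bot_lt_iff_ne_bot.mpr (by simpa using hf.ne_zero)
    · refine lt_of_le_of_lt ?_ (hg₁d i)
      rw [hg₂']
      exact degree_le_of_dvd (dvd_mul_left _ _) (mul_ne_zero he0 h)
  have hfe : ¬ f ∣ e := fun h => by
    have h1 : e ∣ g₁ i₀ := ⟨_, hg₂' i₀⟩
    exact absurd (degree_le_of_dvd (h.trans h1) hg₁0) (not_le.mpr (hg₁d i₀))
  have hdvd₂ : f ∣ ∑ i, ∑ j, C (q i j) * (g₂ i * g₂ j) := by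
    have : ∑ i, ∑ j, C (q i j) * (g₁ i * g₁ j) = e * (e * ∑ i, ∑ j, C (q i j) * (g₂ i * g₂ j)) := by
      simp only [Finset.mul_sum]
      refine Finset.sum_congr rfl fun i _ => Finset.sum_congr rfl fun j _ => ?_
      rw [hg₂' i, hg₂' j]; ring
    rw [this] at hdvd₁
    exact ((hf.prime.dvd_or_dvd hdvd₁).resolve_left hfe |> hf.prime.dvd_or_dvd).resolve_left hfe
  -- degree of the value
  obtain ⟨h, hh⟩ := hdvd₂
  obtain ⟨i₁, -, hi₁⟩ := Finset.exists_max_image Finset.univ (fun i => (g₂ i).natDegree)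
    ⟨i₀, Finset.mem_univ i₀⟩
  obtain ⟨d, hd⟩ : ∃ d, d = (g₂ i₁).natDegree := ⟨_, rfl⟩
  rw [← hd] at hi₁
  have hg₂0 : ∃ i, g₂ i ≠ 0 := ⟨i₀, fun h => hg₁0 (by rw [hg₂', h, mul_zero])⟩
  have hdle : ∀ i, (g₂ i).natDegree ≤ d := fun i => hi₁ i (Finset.mem_univ i)
  have hlead : (fun i => (g₂ i).coeff d) ≠ 0 := by
    intro h0
    by_cases h1 : g₂ i₁ = 0
    · obtain ⟨i, hi⟩ := hg₂0
      have hd0 : d = 0 := by rw [hd, h1, natDegree_zero]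
      have := hdle i
      rw [hd0, Nat.le_zero] at this
      have h2 := congrFun h0 i
      simp only [hd0, Pi.zero_apply] at h2
      rw [eq_C_of_natDegree_eq_zero this, h2, C_0] at hi
      exact hi rfl
    · have h2 := congrFun h0 i₁
      simp only [Pi.zero_apply, hd] at h2
      exact h1 (leadingCoeff_eq_zero.mp h2)
  have hcoeff : (∑ i, ∑ j, C (q i j) * (g₂ i * g₂ j)).coeff (d + d) =
      ∑ i, ∑ j, q i j * ((g₂ i).coeff d * (g₂ j).coeff d) := by
    simp only [finsetSum_coeff, coeff_C_mul]
    refine Finset.sum_congr rfl fun i _ => Finset.sum_congr rfl fun j _ => ?_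
    rw [coeff_mul_add_eq_of_natDegree_le (hdle i) (hdle j)]
  have hne : (∑ i, ∑ j, C (q i j) * (g₂ i * g₂ j)).coeff (d + d) ≠ 0 := fun h0 => by
    rw [hcoeff] at h0
    exact hlead (hq _ h0)
  have hdeg : (∑ i, ∑ j, C (q i j) * (g₂ i * g₂ j)).natDegree = d + d := by
    refine le_antisymm ?_ (le_natDegree_of_ne_zero hne)
    refine natDegree_sum_le_of_forall_le _ _ fun i _ =>
      natDegree_sum_le_of_forall_le _ _ fun j _ => ?_
    refine (natDegree_C_mul_le _ _).trans (natDegree_mul_le.trans ?_)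
    exact add_le_add (hdle i) (hdle j)
  have hh0 : h ≠ 0 := fun h0 => hne (by rw [hh, h0, mul_zero, coeff_zero])
  rw [hh, natDegree_mul hf.ne_zero hh0] at hdeg
  have hdf : d < f.natDegree := by
    rw [hd]
    by_cases h1 : g₂ i₁ = 0
    · rw [h1, natDegree_zero]; exact hodd.pos
    · exact natDegree_lt_natDegree h1 (hg₂d i₁)
  have hhodd : Odd h.natDegree := by
    rcases hodd with ⟨a, ha⟩
    refine ⟨d - a - 1, ?_⟩
    omega
  -- an irreducible factor of odd degree
  have hfac : ∀ h : F[X], h ≠ 0 → Odd h.natDegree →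
      ∃ f', Irreducible f' ∧ Odd f'.natDegree ∧ f' ∣ h := by
    intro h
    induction h using WfDvdMonoid.induction_on_irreducible with
    | zero => intro h; exact absurd rfl h
    | unit u hu =>
      intro _ ho
      rw [natDegree_eq_zero_of_isUnit hu] at ho
      exact absurd ho (by decide)
    | mul a b ha hb ihb =>
      intro _ ho
      rw [natDegree_mul hb.ne_zero ha] at ho
      rcases Nat.even_or_odd b.natDegree with hbe | hbo
      · obtain ⟨f', h1, h2, h3⟩ := ihb ha ((Nat.odd_add'.mp ho).mpr hbe)
        exact ⟨f', h1, h2, h3.mul_left _⟩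
      · exact ⟨b, hb, hbo, dvd_mul_right _ _⟩
  obtain ⟨f', hf', hf'o, hf'h⟩ := hfac h hh0 hhodd
  have hlt : f'.natDegree < n := by
    have := natDegree_le_of_dvd hf'h hh0
    omega
  have hall := ih _ hlt f' hf' hf'o g₂ (hh ▸ hf'h.mul_left _) rfl
  have : f' ∣ Finset.univ.gcd g₂ := Finset.dvd_gcd fun i _ => hall i
  rw [hgcd] at this
  exact hf'.not_isUnit (isUnit_of_dvd_one this)

section

open MvPolynomial

theorem MvPolynomial.sq_dvd_aeval_add_sub {k κ S : Type*} [Field k] [Fintype κ] [CommRing S]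
    [Algebra k S] (p : κ → k) (t : S) (v : κ → S) (f : MvPolynomial κ k) :
    t ^ 2 ∣ aeval (fun i => algebraMap k S (p i) + t * v i) f -
      (algebraMap k S (eval p f) + t * ∑ j, v j * algebraMap k S (eval p (pderiv j f))) := by
  classical
  induction f using MvPolynomial.induction_on with
  | C a => simp
  | add f g hf hg =>
    have := dvd_add hf hg
    convert this using 1
    simp only [map_add, mul_add, Finset.sum_add_distrib]
    ring
  | mul_X f i hf =>
    obtain ⟨c, hc⟩ := hf
    have hc' := eq_add_of_sub_eq hc
    obtain ⟨s, hs⟩ : ∃ s, s = ∑ j, v j * algebraMap k S (eval p (pderiv j f)) := ⟨_, rfl⟩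
    rw [← hs] at hc'
    have h1 : ∑ j, v j * algebraMap k S (eval p (pderiv j (f * X i))) =
        s * algebraMap k S (p i) + algebraMap k S (eval p f) * v i := by
      simp only [Derivation.leibniz, pderiv_X, smul_eq_mul, map_add, map_mul, eval_X, mul_add,
        Finset.sum_add_distrib]
      rw [add_comm, hs, Finset.sum_mul]
      congr 1
      · exact Finset.sum_congr rfl fun j _ => by ring
      · rw [Finset.sum_eq_single i]
        · simp; ring
        · intro j _ hj
          simp [hj]
        · simp
    rw [map_mul, aeval_X, hc', h1, map_mul, eval_X, map_mul]
    exact ⟨c * (algebraMap k S (p i) + t * v i) + s * v i, by ring⟩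

theorem MvPolynomial.linearIndependent_prod_pow {k κ : Type*} [Field k] [Fintype κ]
    (J : κ → κ → k) (hJ : LinearIndependent k J) (s : Finset (κ → ℕ)) (a : (κ → ℕ) → k)
    (h : ∑ α ∈ s, C (a α) * ∏ i, (∑ j, X j * C (J i j)) ^ α i = (0 : MvPolynomial κ k)) :
    ∀ α ∈ s, a α = 0 := by
  classical
  obtain ⟨u, hu⟩ := (Matrix.linearIndependent_rows_iff_isUnit (A := Matrix.of J)).mp hJ
  let φ : MvPolynomial κ k →ₐ[k] MvPolynomial κ k :=
    aeval fun j => ∑ l, C ((↑u⁻¹ : Matrix κ κ k) j l) * X l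
  have hφ : ∀ i, φ (∑ j, X j * C (J i j)) = X i := by
    intro i
    have hinv : Matrix.of J * (↑u⁻¹ : Matrix κ κ k) = 1 := by rw [← hu]; exact u.mul_inv
    simp only [map_sum, map_mul, φ, aeval_X, algHom_C, Finset.sum_mul, algebraMap_eq]
    rw [Finset.sum_comm]
    have : ∀ l, ∑ j, C ((↑u⁻¹ : Matrix κ κ k) j l) * X l * C (J i j) =
        C ((1 : Matrix κ κ k) i l) * (X l : MvPolynomial κ k) := by
      intro l
      rw [← hinv, Matrix.mul_apply, map_sum, Finset.sum_mul]
      refine Finset.sum_congr rfl fun j _ => ?_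
      rw [map_mul, Matrix.of_apply]; ring
    simp only [this, Matrix.one_apply]
    rw [Finset.sum_eq_single i] <;> simp +contextual [eq_comm]
  have h1 := congrArg φ h
  simp only [map_sum, map_mul, map_prod, map_pow, hφ, map_zero] at h1
  intro α hα
  have h2 := congrArg (coeff (Finsupp.equivFunOnFinite.symm α)) h1
  have h3 : ∀ β : κ → ℕ, φ (C (a β)) * ∏ i, (X i : MvPolynomial κ k) ^ β i =
      monomial (Finsupp.equivFunOnFinite.symm β) (a β) := by
    intro β
    rw [monomial_eq, Finsupp.prod_fintype _ _ (by simp)]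
    simp [φ]
  simp only [h3, coeff_sum, coeff_monomial, coeff_zero] at h2
  rw [Finset.sum_eq_single α] at h2
  · simpa using h2
  · intro β _ hβ
    rw [if_neg]
    exact fun h => hβ (Finsupp.equivFunOnFinite.symm.injective h)
  · exact fun h => absurd hα h

theorem MvPolynomial.linearIndependent_prod_pow_mul_indicator {k κ : Type*} [Field k] [Fintype k]
    [Fintype κ] (Z : Finset (κ → k)) (H : (κ → k) → κ → MvPolynomial κ k)
    (e : (κ → k) → κ → ℕ) (hvan : ∀ p ∈ Z, ∀ p' ∈ Z, ∀ i, eval p' (H p i) = 0)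
    (hgrad : ∀ p ∈ Z, LinearIndependent k fun i j => eval p (pderiv j (H p i))) :
    LinearIndependent k fun x : (Σ p : Z, ∀ i, Fin (e p i)) =>
      (∏ i, H x.1 i ^ (x.2 i : ℕ)) * indicator (x.1 : κ → k) := by
  classical
  rw [Fintype.linearIndependent_iff]
  intro g hg
  by_contra! hne
  obtain ⟨x₀, hx₀⟩ := hne
  obtain ⟨⟨p, α⟩, hx₁, hmin⟩ := Finset.exists_min_image
    (Finset.univ.filter fun x : (Σ p : Z, ∀ i, Fin (e p i)) => g x ≠ 0)
    (fun x => ∑ i, (x.2 i : ℕ)) ⟨x₀, by simpa using hx₀⟩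
  obtain ⟨w, hw⟩ : ∃ w, w = ∑ i, (α i : ℕ) := ⟨_, rfl⟩
  simp only [Finset.mem_filter, Finset.mem_univ, true_and, ← hw] at hx₁ hmin
  -- expand around `p`
  let φ : MvPolynomial κ k →ₐ[k] Polynomial (MvPolynomial κ k) :=
    aeval fun i => algebraMap k _ (p.1 i) + Polynomial.X * Polynomial.C (X i)
  have hφ : ∀ f, ∃ c, φ f = algebraMap k _ (eval p.1 f) + Polynomial.X *
      (Polynomial.C (∑ j, X j * C (eval p.1 (pderiv j f))) + Polynomial.X * c) := by
    intro f
    obtain ⟨c, hc⟩ := sq_dvd_aeval_add_sub p.1 (Polynomial.X : Polynomial (MvPolynomial κ k))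
      (fun i => Polynomial.C (X i)) f
    refine ⟨c, ?_⟩
    rw [sub_eq_iff_eq_add] at hc
    change aeval _ f = _
    rw [hc, map_sum]
    have : ∀ a : k, algebraMap k (Polynomial (MvPolynomial κ k)) a =
      Polynomial.C (C a) := fun a => rfl
    simp only [this, map_mul]
    ring
  have hφ0 : ∀ f, eval p.1 f = 0 → ∃ c, φ f = Polynomial.X *
      (Polynomial.C (∑ j, X j * C (eval p.1 (pderiv j f))) + Polynomial.X * c) := by
    intro f hf
    obtain ⟨c, hc⟩ := hφ f
    exact ⟨c, by rw [hc, hf, map_zero, zero_add]⟩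
  have hdvd : ∀ f, eval p.1 f = 0 → Polynomial.X ∣ φ f := fun f hf => by
    obtain ⟨c, hc⟩ := hφ0 f hf
    exact ⟨_, hc⟩
  have hprod : ∀ x : (Σ p : Z, ∀ i, Fin (e p i)),
      Polynomial.X ^ (∑ i, (x.2 i : ℕ)) ∣ φ (∏ i, H x.1 i ^ (x.2 i : ℕ)) := by
    intro x
    rw [map_prod, ← Finset.prod_pow_eq_pow_sum]
    refine Finset.prod_dvd_prod_of_dvd _ _ fun i _ => ?_
    rw [map_pow]
    exact pow_dvd_pow_of_dvd (hdvd _ (hvan _ x.1.2 _ p.2 i)) _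
  have hcoeff0 : ∀ x : (Σ p : Z, ∀ i, Fin (e p i)), g x ≠ 0 →
      ¬ (x.1 = p ∧ ∑ i, (x.2 i : ℕ) = w) →
      (φ ((∏ i, H x.1 i ^ (x.2 i : ℕ)) * indicator (x.1 : κ → k))).coeff w = 0 := by
    intro x hx hxp
    have hle := hmin x hx
    rw [map_mul]
    by_cases hxw : ∑ i, (x.2 i : ℕ) = w
    · have hne : (p : κ → k) ≠ x.1 := fun h => hxp ⟨(Subtype.ext h).symm, hxw⟩
      have h1 := mul_dvd_mul (hprod x) (hdvd _ (eval_indicator_apply_eq_zero _ _ hne))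
      rw [← pow_succ, Polynomial.X_pow_dvd_iff] at h1
      exact h1 _ (by omega)
    · have h1 := (hprod x).mul_right (φ (indicator (x.1 : κ → k)))
      rw [Polynomial.X_pow_dvd_iff] at h1
      exact h1 _ (by omega)
  have hcoeff1 : ∀ β : (∀ i, Fin (e p i)), ∑ i, (β i : ℕ) = w →
      (φ ((∏ i, H p i ^ (β i : ℕ)) * indicator (p : κ → k))).coeff w =
        ∏ i, (∑ j, X j * C (eval p.1 (pderiv j (H p i)))) ^ (β i : ℕ) := by
    intro β hβ
    choose c hc using fun i => hφ0 (H p i) (hvan _ p.2 _ p.2 i)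
    rw [map_mul, map_prod]
    simp only [map_pow, hc, mul_pow, Finset.prod_mul_distrib]
    rw [Finset.prod_pow_eq_pow_sum, hβ, mul_assoc, mul_comm, Polynomial.coeff_mul_X_pow',
      if_pos le_rfl, Nat.sub_self, Polynomial.mul_coeff_zero, Polynomial.coeff_zero_prod]
    obtain ⟨c', hc'⟩ := hφ (indicator (p : κ → k))
    rw [hc', eval_indicator_apply_eq_one]
    simp only [Polynomial.coeff_zero_eq_eval_zero, Polynomial.eval_pow, Polynomial.eval_add,
      Polynomial.eval_C, Polynomial.eval_mul, Polynomial.eval_X, zero_mul, add_zero, map_one,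
      Polynomial.eval_one, mul_one]
  have hsum := congrArg (fun f => (φ f).coeff w) hg
  simp only [map_sum, map_smul, map_zero, Polynomial.finsetSum_coeff, Polynomial.coeff_smul,
    Polynomial.coeff_zero] at hsum
  rw [Fintype.sum_sigma, Finset.sum_eq_single p] at hsum
  rotate_left
  · intro p' _ hp'
    refine Finset.sum_eq_zero fun β _ => ?_
    by_cases h0 : g ⟨p', β⟩ = 0
    · rw [h0, zero_smul]
    · rw [hcoeff0 ⟨p', β⟩ h0 (fun h => hp' h.1), smul_zero]
  · simp
  let T : Finset (∀ i, Fin (e p i)) := Finset.univ.filter fun β => ∑ i, (β i : ℕ) = w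
  have hsum' : ∑ β ∈ T, C (g ⟨p, β⟩) *
      ∏ i, (∑ j, X j * C (eval p.1 (pderiv j (H p i)))) ^ (β i : ℕ) = (0 : MvPolynomial κ k) := by
    rw [← hsum, Finset.sum_filter]
    refine Finset.sum_congr rfl fun β _ => ?_
    split_ifs with hβ
    · rw [hcoeff1 β hβ, C_mul']
    · by_cases h0 : g ⟨p, β⟩ = 0
      · rw [h0, zero_smul]
      · rw [hcoeff0 ⟨p, β⟩ h0 (fun h => hβ h.2), smul_zero]
  let ι : (∀ i, Fin (e p i)) ↪ (κ → ℕ) :=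
    ⟨fun β i => β i, fun β β' h => _root_.funext fun i => Fin.ext (congrFun h i)⟩
  have hfin := linearIndependent_prod_pow _ (hgrad p p.2) (T.map ι)
    (fun γ => if h : ∃ β, ι β = γ then g ⟨p, h.choose⟩ else 0) (by
      rw [Finset.sum_map, ← hsum']
      refine Finset.sum_congr rfl fun β _ => ?_
      have h : ∃ β', ι β' = ι β := ⟨β, rfl⟩
      rw [dif_pos h, ι.injective h.choose_spec]
      rfl) (ι α) (Finset.mem_map_of_mem _ (by simp [T, hw]))
  have h : ∃ β', ι β' = ι α := ⟨α, rfl⟩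
  rw [dif_pos h, ι.injective h.choose_spec] at hfin
  exact hx₁ hfin

theorem MvPolynomial.sum_prod_le_of_linearIndependent_pderiv {k κ : Type*} [Field k] [Fintype k]
    [Fintype κ] (Z : Finset (κ → k)) (H : (κ → k) → κ → MvPolynomial κ k)
    (e : (κ → k) → κ → ℕ) (Δ : ℕ) (hvan : ∀ p ∈ Z, ∀ p' ∈ Z, ∀ i, eval p' (H p i) = 0)
    (hgrad : ∀ p ∈ Z, LinearIndependent k fun i j => eval p (pderiv j (H p i)))
    (hdeg : ∀ p ∈ Z, ∀ i, e p i * (H p i).totalDegree ≤ Δ) :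
    ∑ p ∈ Z, ∏ i, e p i ≤ (Fintype.card κ * Δ + 1) ^ Fintype.card κ := by
  classical
  obtain ⟨δ, hδ⟩ : ∃ δ, ∀ p ∈ Z, (indicator p : MvPolynomial κ k).totalDegree ≤ δ :=
    ⟨Z.sup fun p => (indicator p : MvPolynomial κ k).totalDegree,
      fun p hp => Finset.le_sup (f := fun p => (indicator p : MvPolynomial κ k).totalDegree) hp⟩
  let t := δ + 1
  let r := Fintype.card κ
  have hli := linearIndependent_prod_pow_mul_indicator Z H (fun p i => t * e p i) hvan hgrad
  let n := r * (t * Δ) + δ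
  have hmem : ∀ x : (Σ p : Z, ∀ i, Fin (t * e p i)),
      (∏ i, H x.1 i ^ (x.2 i : ℕ)) * indicator (x.1 : κ → k) ∈ restrictDegree κ k n := by
    intro x
    rw [mem_restrictDegree]
    intro s hs i
    have h1 : s.degree ≤ totalDegree ((∏ i, H x.1 i ^ (x.2 i : ℕ)) * indicator (x.1 : κ → k)) :=
      le_totalDegree hs
    have h2 : s i ≤ s.degree := Finsupp.le_degree i s
    refine h2.trans (h1.trans ((totalDegree_mul _ _).trans (add_le_add ?_ (hδ _ x.1.2))))
    refine (totalDegree_finsetProd _ _).trans ?_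
    refine (Finset.sum_le_card_nsmul _ _ (t * Δ) fun i _ => ?_).trans (by simp [r])
    refine (totalDegree_pow _ _).trans ?_
    refine (Nat.mul_le_mul_right _ (x.2 i).2.le).trans ?_
    rw [mul_assoc]
    exact Nat.mul_le_mul_left _ (hdeg _ x.1.2 i)
  have hli' : LinearIndependent k fun x => (⟨_, hmem x⟩ : restrictDegree κ k n) :=
    LinearIndependent.of_comp (restrictDegree κ k n).subtype hli
  let b := basisRestrictSupport k {s : κ →₀ ℕ | ∀ i, s i ≤ n}
  have hfin : {s : κ →₀ ℕ | ∀ i, s i ≤ n} ≃ (κ → Fin (n + 1)) :=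
    { toFun := fun s i => ⟨s.1 i, Nat.lt_succ_of_le (s.2 i)⟩
      invFun := fun f => ⟨Finsupp.equivFunOnFinite.symm fun i => f i, fun i => by
        simpa using Nat.le_of_lt_succ (f i).2⟩
      left_inv := fun s => by ext; simp
      right_inv := fun f => by ext; simp }
  let : Fintype {s : κ →₀ ℕ | ∀ i, s i ≤ n} := Fintype.ofEquiv _ hfin.symm
  have hrank : Module.finrank k (restrictDegree κ k n) = (n + 1) ^ r := by
    have := Module.finrank_eq_card_basis b
    rw [Fintype.card_congr hfin, Fintype.card_fun, Fintype.card_fin] at this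
    exact this
  have : FiniteDimensional k (restrictDegree κ k n) := Module.Finite.of_basis b
  have hle := hli'.fintype_card_le_finrank
  rw [hrank, Fintype.card_sigma] at hle
  simp only [Fintype.card_pi, Fintype.card_fin, Finset.prod_mul_distrib, Finset.prod_const,
    Finset.card_univ] at hle
  rw [← Finset.mul_sum, Finset.univ_eq_attach, Finset.sum_attach Z fun p => ∏ i, e p i] at hle
  have h2 : n + 1 ≤ t * (r * Δ + 1) := by
    simp only [n, t]; nlinarith
  have h3 := hle.trans (Nat.pow_le_pow_left h2 r)
  rw [mul_pow] at h3
  exact Nat.le_of_mul_le_mul_left h3 (by positivity)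

/-- A bound for the number of points over a finite field of a variety whose tangent spaces have
dimension at most `d`. -/
theorem MvPolynomial.card_le_of_finrank_span_pderiv {k κ : Type*} [Field k] [Fintype k]
    [Fintype κ] (Z : Finset (κ → k)) (D d : ℕ) (hD : 1 ≤ D) (hd : d ≤ Fintype.card κ)
    (h : ∀ p ∈ Z, Fintype.card κ ≤ d + Module.finrank k (Submodule.span k
      {g : κ → k | ∃ G : MvPolynomial κ k, G.totalDegree ≤ D ∧ (∀ p' ∈ Z, eval p' G = 0) ∧
        g = fun j => eval p (pderiv j G)})) :
    Z.card ≤ (Fintype.card κ * D + 1) ^ Fintype.card κ * Fintype.card k ^ d := by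
  classical
  let q := Fintype.card k
  let r := Fintype.card κ
  have hq : 1 < q := Fintype.one_lt_card
  have key : ∀ p ∈ Z, ∃ (H : κ → MvPolynomial κ k) (e : κ → ℕ), (∀ p' ∈ Z, ∀ i, eval p' (H i) = 0) ∧
      (LinearIndependent k fun i j => eval p (pderiv j (H i))) ∧
      (∀ i, e i * (H i).totalDegree ≤ D * q) ∧ q ^ (r - d) ≤ ∏ i, e i := by
    intro p hp
    set S : Set (κ → k) := {g : κ → k | ∃ G : MvPolynomial κ k, G.totalDegree ≤ D ∧
      (∀ p' ∈ Z, eval p' G = 0) ∧ g = fun j => eval p (pderiv j G)} with hS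
    have hp' := h p hp
    obtain ⟨b₁, hb₁S, hb₁span, hb₁⟩ := exists_linearIndependent k S
    let std : Set (κ → k) := Set.range fun i => (Pi.single i 1 : κ → k)
    have hb₁t : b₁ ⊆ b₁ ∪ std := Set.subset_union_left
    obtain ⟨b₂, hb₂sub, hb₁₂, hb₂span, hb₂⟩ := exists_linearIndepOn_id_extension hb₁ hb₁t
    have hspan : ⊤ ≤ Submodule.span k (Set.range ((↑) : b₂ → κ → k)) := by
      rw [Subtype.range_coe, ← (Pi.basisFun k κ).span_eq, Submodule.span_le]
      rintro _ ⟨i, rfl⟩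
      exact hb₂span (Or.inr ⟨i, by simp⟩)
    let B : Module.Basis b₂ k (κ → k) := Module.Basis.mk hb₂ hspan
    have : Fintype b₂ := FiniteDimensional.fintypeBasisIndex B
    have hcard : Fintype.card b₂ = Fintype.card κ := by
      rw [← Module.finrank_eq_card_basis B, Module.finrank_fintype_fun_eq_card]
    obtain ⟨σ⟩ := Fintype.card_eq.mp hcard.symm
    have hel : ∀ g ∈ b₂, ∃ (G : MvPolynomial κ k) (e : ℕ), (∀ p' ∈ Z, eval p' G = 0) ∧
        (∃ c : k, c ≠ 0 ∧ (fun j => eval p (pderiv j G)) = c • g) ∧ e * G.totalDegree ≤ D * q ∧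
        1 ≤ e ∧ (g ∈ b₁ → q ≤ e) := by
      intro g hg
      by_cases hgb : g ∈ b₁
      · obtain ⟨G, h1, h2, h3⟩ := hb₁S hgb
        exact ⟨G, q, h2, ⟨1, one_ne_zero, by rw [h3, one_smul]⟩,
          by rw [mul_comm]; exact Nat.mul_le_mul_right _ h1, hq.le, fun _ => le_rfl⟩
      · obtain ⟨i, rfl⟩ := (hb₂sub hg).resolve_left hgb
        refine ⟨X i ^ q - X i, D, fun p' _ => ?_, ⟨-1, by simp, ?_⟩, ?_, hD, fun h => absurd h hgb⟩
        · simp [q, FiniteField.pow_card]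
        · ext j
          have : ((q : ℕ) : k) = 0 := FiniteField.cast_card_eq_zero k
          rw [map_sub, Derivation.leibniz_pow, ← Nat.cast_smul_eq_nsmul k, this, zero_smul,
            zero_sub,
            map_neg, pderiv_X, Pi.smul_apply, smul_eq_mul, neg_one_mul]
          change _ = -(Pi.single i 1 : κ → k) j
          by_cases hij : i = j
          · subst hij
            rw [Pi.single_eq_same, Pi.single_eq_same, map_one]
          · rw [Pi.single_eq_of_ne hij, Pi.single_eq_of_ne (Ne.symm hij), map_zero]
        · refine Nat.mul_le_mul_left _ ((totalDegree_sub _ _).trans (max_le ?_ ?_))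
          · exact (totalDegree_pow _ _).trans (by rw [totalDegree_X, mul_one])
          · rw [totalDegree_X]; exact hq.le
    choose! G e hG1 hG2 hG3 hG4 hG5 using hel
    refine ⟨fun i => G (σ i), fun i => e (σ i), fun p' hp' i => hG1 _ (σ i).2 _ hp', ?_,
      fun i => hG3 _ (σ i).2, ?_⟩
    · choose c hc0 hc using fun i => hG2 (σ i) (σ i).2
      have h1 : LinearIndependent k fun i => ((σ i : b₂) : κ → k) :=
        LinearIndependent.comp hb₂ σ σ.injective
      convert h1.units_smul fun i => Units.mk0 (c i) (hc0 i) using 1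
      exact _root_.funext fun i => hc i
    · have hb₁card : r - d ≤ (Finset.univ.filter fun i => ((σ i : b₂) : κ → k) ∈ b₁).card := by
        have : Fintype b₁ := ((Set.toFinite b₂).subset hb₁₂).fintype
        have h1 := finrank_span_set_eq_card hb₁
        rw [hb₁span, Set.toFinset_card] at h1
        have h2 : Fintype.card b₁ ≤
            (Finset.univ.filter fun i => ((σ i : b₂) : κ → k) ∈ b₁).card := by
          rw [← Fintype.card_subtype]
          refine Fintype.card_le_of_injective
            (fun g => ⟨σ.symm ⟨g, hb₁₂ g.2⟩, by simp⟩) fun g g' hgg' => ?_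
          simpa [Subtype.ext_iff] using hgg'
        refine le_trans ?_ h2
        rw [← h1]
        exact Nat.sub_le_iff_le_add'.mpr hp'
      calc q ^ (r - d) ≤ q ^ (Finset.univ.filter fun i => ((σ i : b₂) : κ → k) ∈ b₁).card :=
            Nat.pow_le_pow_right hq.le hb₁card
        _ = ∏ i, if ((σ i : b₂) : κ → k) ∈ b₁ then q else 1 := by
            rw [Finset.prod_ite]; simp
        _ ≤ ∏ i, e (σ i) := Finset.prod_le_prod' fun i _ => by
            split_ifs with hi
            · exact hG5 _ (σ i).2 hi
            · exact hG4 _ (σ i).2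
  choose! H e h1 h2 h3 h4 using key
  have hmain := sum_prod_le_of_linearIndependent_pderiv Z H e (D * q) h1 h2 h3
  have h5 : Z.card * q ^ (r - d) ≤ ∑ p ∈ Z, ∏ i, e p i := by
    rw [← smul_eq_mul]
    exact Finset.card_nsmul_le_sum _ _ _ h4
  have h6 : r * (D * q) + 1 ≤ (r * D + 1) * q := by nlinarith
  have h7 := (h5.trans hmain).trans (Nat.pow_le_pow_left h6 r)
  have h8 : q ^ r = q ^ d * q ^ (r - d) := by rw [← pow_add]; congr 1; omega
  rw [mul_pow, h8, ← mul_assoc] at h7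
  exact Nat.le_of_mul_le_mul_right h7 (by positivity)

end

/-- The radical of the restriction to `W` of the bilinear form `(x, y) ↦ c ⬝ᵥ B x y`. -/
def radicalOn {k κ V : Type*} [Field k] [Fintype κ] [AddCommGroup V] [Module k V]
    (B : V →ₗ[k] V →ₗ[k] κ → k) (c : κ → k) (W : Submodule k V) : Submodule k V where
  carrier := {x | x ∈ W ∧ ∀ y ∈ W, c ⬝ᵥ B x y = 0}
  add_mem' := fun {a b} ha hb => ⟨W.add_mem ha.1 hb.1, fun y hy => by
    rw [map_add, LinearMap.add_apply, dotProduct_add, ha.2 y hy, hb.2 y hy, add_zero]⟩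
  zero_mem' := ⟨W.zero_mem, fun y _ => by simp⟩
  smul_mem' := fun a x hx => ⟨W.smul_mem a hx.1, fun y hy => by
    rw [map_smul, LinearMap.smul_apply, dotProduct_smul, hx.2 y hy, smul_zero]⟩

theorem radicalOn_le {k κ V : Type*} [Field k] [Fintype κ] [AddCommGroup V] [Module k V]
    (B : V →ₗ[k] V →ₗ[k] κ → k) (c : κ → k) (W : Submodule k V) : radicalOn B c W ≤ W :=
  fun _ hx => hx.1

theorem vecMul_gram {k κ V ι ι' : Type*} [Field k] [Fintype κ] [AddCommGroup V]
    [Module k V] [Fintype ι] (B : V →ₗ[k] V →ₗ[k] κ → k) (c : κ → k) (s : ι → V) (t : ι' → V)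
    (u : ι → k) (j : ι') :
    Matrix.vecMul u (Matrix.of fun i j => c ⬝ᵥ B (s i) (t j)) j =
      c ⬝ᵥ B (∑ i, u i • s i) (t j) := by
  simp only [map_sum, LinearMap.sum_apply, map_smul, LinearMap.smul_apply, dotProduct_sum,
    dotProduct_smul]
  rfl

theorem det_gram_eq_zero_of_finrank_lt {k κ V ι : Type*} [Field k] [Fintype κ] [AddCommGroup V]
    [Module k V] [FiniteDimensional k V] [Fintype ι] [DecidableEq ι]
    (B : V →ₗ[k] V →ₗ[k] κ → k) (c : κ → k)
    (W : Submodule k V) (s t : ι → V) (hs : ∀ i, s i ∈ W) (ht : ∀ i, t i ∈ W)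
    (h : Module.finrank k W < Fintype.card ι + Module.finrank k (radicalOn B c W)) :
    (Matrix.of fun i j => c ⬝ᵥ B (s i) (t j)).det = 0 := by
  let R := (radicalOn B c W).submoduleOf W
  have hR : Module.finrank k R = Module.finrank k (radicalOn B c W) :=
    (Submodule.submoduleOfEquivOfLe (radicalOn_le B c W)).finrank_eq
  let s' : ι → W ⧸ R := fun i => R.mkQ ⟨s i, hs i⟩
  have hdep : ¬ LinearIndependent k s' := fun hli => by
    have h1 := hli.fintype_card_le_finrank
    have h2 := R.finrank_quotient_add_finrank
    omega
  rw [Fintype.not_linearIndependent_iff] at hdep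
  obtain ⟨u, hu, i, hi⟩ := hdep
  rw [← Matrix.exists_vecMul_eq_zero_iff]
  refine ⟨u, fun h0 => hi (congrFun h0 i), ?_⟩
  have h1 : (∑ i, u i • (⟨s i, hs i⟩ : W)) ∈ R := by
    rw [← Submodule.Quotient.mk_eq_zero, ← hu, ← Submodule.mkQ_apply, map_sum]
    exact Finset.sum_congr rfl fun i _ => map_smul _ _ _
  have h2 := (Submodule.mem_comap.mp h1 : _ ∈ radicalOn B c W)
  ext j
  have h3 := h2.2 (t j) (ht j)
  rw [map_sum] at h3
  rw [vecMul_gram]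
  exact h3

theorem det_gram_ne_zero {k κ V ι : Type*} [Field k] [Fintype κ] [AddCommGroup V]
    [Module k V] [Fintype ι] [DecidableEq ι]
    (B : V →ₗ[k] V →ₗ[k] κ → k) (hB : ∀ x y, B x y = B y x) (c : κ → k)
    (W U : Submodule k V) (hU : Disjoint (radicalOn B c W) U) (hW : radicalOn B c W ⊔ U = W)
    (e : Module.Basis ι k U) :
    (Matrix.of fun i j => c ⬝ᵥ B (e i) (e j)).det ≠ 0 := by
  intro h0
  rw [← Matrix.exists_vecMul_eq_zero_iff] at h0
  obtain ⟨u, hu, h0⟩ := h0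
  have h1 : ∀ j, c ⬝ᵥ B (∑ i, u i • (e i : V)) (e j) = 0 := by
    intro j
    rw [← vecMul_gram B c (fun i => (e i : V)) (fun i => (e i : V)) u j, h0, Pi.zero_apply]
  have hmemU : ∑ i, u i • (e i : V) ∈ U := U.sum_mem fun i _ => U.smul_mem _ (e i).2
  have hmemW : ∑ i, u i • (e i : V) ∈ W := by rw [← hW]; exact Submodule.mem_sup_right hmemU
  have h2 : ∑ i, u i • (e i : V) ∈ radicalOn B c W := by
    refine ⟨hmemW, fun y hy => ?_⟩
    rw [← hW] at hy
    obtain ⟨a, ha, b, hb, rfl⟩ := Submodule.mem_sup.mp hy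
    rw [map_add, dotProduct_add, hB _ a, ha.2 _ hmemW, zero_add]
    have hb' := congrArg Subtype.val (e.sum_repr ⟨b, hb⟩)
    simp only [AddSubmonoidClass.coe_finsetSum, SetLike.val_smul] at hb'
    rw [← hb', map_sum, dotProduct_sum]
    refine Finset.sum_eq_zero fun j _ => ?_
    rw [map_smul, dotProduct_smul, h1, smul_zero]
  have h3 := (Submodule.disjoint_def.mp hU) _ h2 hmemU
  have h4 : ∑ i, u i • e i = 0 := Subtype.ext (by simpa using h3)
  exact hu (_root_.funext fun i => Fintype.linearIndependent_iff.mp e.linearIndependent u h4 i)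

section
open MvPolynomial

theorem MvPolynomial.totalDegree_det_le {k κ ι : Type*} [Field k] [Fintype ι] [DecidableEq ι]
    (A : Matrix ι ι (MvPolynomial κ k)) (hA : ∀ i j, (A i j).totalDegree ≤ 1) :
    A.det.totalDegree ≤ Fintype.card ι := by
  rw [Matrix.det_apply]
  refine totalDegree_finsetSum_le fun σ _ => ?_
  refine (totalDegree_smul_le _ _).trans ((totalDegree_finsetProd _ _).trans ?_)
  exact (Finset.sum_le_card_nsmul _ _ 1 fun i _ => hA _ _).trans (by simp)

/-- The gradient of a bordered Gram determinant. -/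
theorem MvPolynomial.exists_gradient_eq {k κ V ι : Type*} [Field k] [Fintype κ] [AddCommGroup V]
    [Module k V] [Fintype ι] [DecidableEq ι] (B : V →ₗ[k] V →ₗ[k] κ → k) (p : κ → k)
    (e : ι → V) (v w : V) (hv : ∀ i, p ⬝ᵥ B (e i) w = 0) (hw : ∀ i, p ⬝ᵥ B v (e i) = 0)
    (hvw : p ⬝ᵥ B v w = 0) :
    ∃ G : MvPolynomial κ k, G.totalDegree ≤ Fintype.card ι + 1 ∧
      (∀ c, eval c G = (Matrix.of fun i j : ι ⊕ Unit =>
        c ⬝ᵥ B (Sum.elim e (fun _ => v) i) (Sum.elim e (fun _ => w) j)).det) ∧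
      (fun j => eval p (pderiv j G)) = (Matrix.of fun i j => p ⬝ᵥ B (e i) (e j)).det • B v w := by
  classical
  let L : V → V → MvPolynomial κ k := fun x y => ∑ l, X l * C (B x y l)
  let A : Matrix (ι ⊕ Unit) (ι ⊕ Unit) (MvPolynomial κ k) := Matrix.of fun i j =>
    L (Sum.elim e (fun _ => v) i) (Sum.elim e (fun _ => w) j)
  refine ⟨A.det, ?_, fun c => ?_, ?_⟩
  · refine (totalDegree_det_le A fun i j => ?_).trans (by simp)
    refine totalDegree_finsetSum_le fun l _ => (totalDegree_mul _ _).trans ?_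
    rw [totalDegree_X, totalDegree_C]
  · rw [RingHom.map_det]
    congr 1
    ext i j
    simp [A, L, dotProduct]
  · have hpair : ∀ u : κ → k, u ⬝ᵥ (fun j => eval p (pderiv j A.det)) =
        u ⬝ᵥ ((Matrix.of fun i j => p ⬝ᵥ B (e i) (e j)).det • B v w) := by
      intro u
      have hT := sq_dvd_aeval_add_sub p (Polynomial.X : Polynomial k)
        (fun i => Polynomial.C (u i)) A.det
      obtain ⟨φ, hφ⟩ : ∃ φ : MvPolynomial κ k →ₐ[k] (Polynomial k), φ = aeval fun i =>
        algebraMap k (Polynomial k) (p i) + Polynomial.X * Polynomial.C (u i) := ⟨_, rfl⟩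
      have hL : ∀ x y, φ (L x y) =
          Polynomial.C (p ⬝ᵥ B x y) + Polynomial.X * Polynomial.C (u ⬝ᵥ B x y) := by
        intro x y
        simp only [hφ, L, map_sum, map_mul, aeval_X, algHom_C, dotProduct, Finset.mul_sum,
          ← Finset.sum_add_distrib]
        refine Finset.sum_congr rfl fun l _ => ?_
        have : ∀ a, algebraMap k (Polynomial k) a = Polynomial.C a := fun a => rfl
        rw [this, this]
        ring
      let P : Matrix ι ι (Polynomial k) := Matrix.of fun i j =>
        Polynomial.C (p ⬝ᵥ B (e i) (e j)) + Polynomial.X * Polynomial.C (u ⬝ᵥ B (e i) (e j))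
      let Q : Matrix ι Unit (Polynomial k) := Matrix.of fun i _ =>
        Polynomial.X * Polynomial.C (u ⬝ᵥ B (e i) w)
      let R : Matrix Unit ι (Polynomial k) := Matrix.of fun _ i => Polynomial.C (u ⬝ᵥ B v (e i))
      let d : Matrix Unit Unit (Polynomial k) := Matrix.of fun _ _ => Polynomial.C (u ⬝ᵥ B v w)
      have hA : φ A.det = Polynomial.X * (Matrix.fromBlocks P Q R d).det := by
        have h1 : (Matrix.of fun _ _ : Unit => (Polynomial.X : Polynomial k)).det =
            Polynomial.X := by simp
        have h2 : (Matrix.fromBlocks (1 : Matrix ι ι (Polynomial k)) 0 0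
            (Matrix.of fun _ _ : Unit => (Polynomial.X : Polynomial k))).det = Polynomial.X := by
          rw [Matrix.det_fromBlocks_zero₂₁, h1, Matrix.det_one, one_mul]
        rw [← h2, ← Matrix.det_mul, Matrix.fromBlocks_multiply, AlgHom.map_det]
        congr 1
        ext1 i j
        rcases i with i | i <;> rcases j with j | j
        all_goals
          simp [A, hL, P, Q, R, d, hv, hw, hvw, Matrix.mul_apply]
      obtain ⟨c, hc⟩ := hT
      change _ - _ = _ at hc
      rw [← hφ, hA] at hc
      have hc1 := congrArg (fun f => Polynomial.coeff f 1) hc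
      have hs : (Polynomial.X : Polynomial k) * ∑ j, Polynomial.C (u j) *
          algebraMap k (Polynomial k) (eval p (pderiv j A.det)) =
          Polynomial.X * Polynomial.C (u ⬝ᵥ fun j => eval p (pderiv j A.det)) := by
        simp [dotProduct]
      rw [hs] at hc1
      have hz : (Matrix.fromBlocks P Q R d).det.coeff 0 =
          (Matrix.of fun i j => p ⬝ᵥ B (e i) (e j)).det * (u ⬝ᵥ B v w) := by
        rw [Polynomial.coeff_zero_eq_eval_zero, ← Polynomial.coe_evalRingHom, RingHom.map_det,
          RingHom.mapMatrix_apply, Matrix.fromBlocks_map]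
        have : Q.map (Polynomial.evalRingHom 0) = 0 := by
          ext i j; simp [Q]
        rw [this, Matrix.det_fromBlocks_zero₁₂]
        congr 1
        · congr 1
          ext i j; simp [P]
        · simp [d]
      have hx2 : (Polynomial.X ^ 2 * c).coeff 1 = 0 := by
        rw [Polynomial.coeff_X_pow_mul']; simp
      simp only [Polynomial.coeff_sub, Polynomial.coeff_add, Polynomial.coeff_X_mul, hx2] at hc1
      rw [hz] at hc1
      rw [dotProduct_smul, smul_eq_mul]
      simp [Polynomial.coeff_C] at hc1
      linear_combination -hc1
    have := fun j => hpair (Pi.single j 1)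
    ext j
    simpa using this j
end

theorem card_le_finrank_span_add_finrank_orthogonal {k κ : Type*} [Field k] [Fintype κ]
    (S : Set (κ → k)) : ∃ T : Submodule k (κ → k), (∀ c ∈ T, ∀ g ∈ S, c ⬝ᵥ g = 0) ∧
      Fintype.card κ ≤ Module.finrank k (Submodule.span k S) + Module.finrank k T := by
  let L := Submodule.span k S
  let φ : (κ → k) →ₗ[k] Module.Dual k L :=
    { toFun := fun c =>
        { toFun := fun g => c ⬝ᵥ (g : κ → k)
          map_add' := fun a b => dotProduct_add _ _ _
          map_smul' := fun a b => dotProduct_smul _ _ _ }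
      map_add' := fun a b => LinearMap.ext fun g => add_dotProduct _ _ _
      map_smul' := fun a b => LinearMap.ext fun g => smul_dotProduct _ _ _ }
  refine ⟨LinearMap.ker φ, fun c hc g hg => ?_, ?_⟩
  · exact DFunLike.congr_fun (LinearMap.mem_ker.mp hc) ⟨g, Submodule.subset_span hg⟩
  · have h1 := φ.finrank_range_add_finrank_ker
    have h2 := Submodule.finrank_le (LinearMap.range φ)
    rw [Subspace.dual_finrank_eq] at h2
    rw [Module.finrank_fintype_fun_eq_card] at h1
    change _ ≤ Module.finrank k L + _
    omega

/-- The number of forms in a linear system with a given rank on `W`. -/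
theorem card_rank_stratum_le {k κ V : Type*} [Field k] [Fintype k] [Fintype κ] [AddCommGroup V]
    [Module k V] [FiniteDimensional k V] (B : V →ₗ[k] V →ₗ[k] κ → k)
    (hB : ∀ x y, B x y = B y x)
    (hstar : ∀ (C : Submodule k (κ → k)) (W : Submodule k V),
      (∀ c ∈ C, ∀ x ∈ W, ∀ y ∈ W, c ⬝ᵥ B x y = 0) →
      Module.finrank k V * Module.finrank k C + 2 * Fintype.card κ * Module.finrank k W ≤
        2 * Fintype.card κ * Module.finrank k V)
    (hn : 4 * Fintype.card κ < Module.finrank k V) (N : ℕ) (hN : Module.finrank k V ≤ N)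
    (W : Submodule k V) (R : ℕ) (Z : Finset (κ → k))
    (hZ : ∀ c, c ∈ Z ↔ c ≠ 0 ∧ Module.finrank k (radicalOn B c W) + R = Module.finrank k W) :
    Z.card ^ 2 * Fintype.card k * Fintype.card k ^ Module.finrank k W ≤
      ((N * (N + 1) + 1) ^ N) ^ 2 * Fintype.card k ^ (Module.finrank k V + R) := by
  classical
  rcases Z.eq_empty_or_nonempty with rfl | ⟨c₀, hc₀⟩
  · simp
  obtain ⟨n, hn_def⟩ : ∃ n, n = Module.finrank k V := ⟨_, rfl⟩
  obtain ⟨r, hr⟩ : ∃ r, r = Fintype.card κ := ⟨_, rfl⟩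
  obtain ⟨m, hm⟩ : ∃ m, m = Module.finrank k W := ⟨_, rfl⟩
  have hmn : m ≤ n := by rw [hm, hn_def]; exact Submodule.finrank_le W
  rw [← hn_def, ← hr] at hstar hn
  rw [← hn_def] at hN
  rw [← hm] at hZ
  rw [← hn_def, ← hm]
  have hrad : ∀ p ∈ Z, ∀ T : Submodule k (κ → k),
      (∀ c ∈ T, ∀ x ∈ radicalOn B p W, ∀ y ∈ radicalOn B p W, c ⬝ᵥ B x y = 0) →
      Module.finrank k T = 0 ∨ 2 * Module.finrank k T < (n - m) + R := by
    intro p hp T hT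
    have h1 := hstar T _ hT
    have h2 := ((hZ p).mp hp).2
    rcases Nat.eq_zero_or_pos (Module.finrank k T) with h | h
    · exact Or.inl h
    · right
      by_contra! hcon
      have h3 : 4 * r * Module.finrank k T < n * Module.finrank k T := by gcongr
      have h4 : n = Module.finrank k (radicalOn B p W) + ((n - m) + R) := by omega
      have h5 : 2 * r * n = 2 * r * Module.finrank k (radicalOn B p W) +
          2 * r * ((n - m) + R) := by rw [← mul_add, ← h4]
      nlinarith [Nat.mul_le_mul_left (2 * r) hcon]
  have hpos : 1 ≤ (n - m) + R := by
    have h1 := hrad c₀ hc₀ (Submodule.span k {c₀}) (fun c hc x hx y hy => by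
      obtain ⟨a, rfl⟩ := Submodule.mem_span_singleton.mp hc
      rw [smul_dotProduct, hx.2 y hy.1, smul_zero])
    rw [finrank_span_singleton ((hZ c₀).mp hc₀).1] at h1
    omega
  have hRn : R ≤ n := by have := ((hZ c₀).mp hc₀).2; omega
  let d := min ((n - m + R - 1) / 2) r
  have hcard := MvPolynomial.card_le_of_finrank_span_pderiv Z (R + 1) d (by omega)
    (by rw [← hr]; exact min_le_right _ _) (by
      intro p hp
      set S : Set (κ → k) := {g : κ → k | ∃ G : MvPolynomial κ k, G.totalDegree ≤ R + 1 ∧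
        (∀ p' ∈ Z, MvPolynomial.eval p' G = 0) ∧
        g = fun j => MvPolynomial.eval p (MvPolynomial.pderiv j G)} with hS
      obtain ⟨T, hT, hle⟩ := card_le_finrank_span_add_finrank_orthogonal S
      have hp' := (hZ p).mp hp
      obtain ⟨U', hU'⟩ := Submodule.exists_isCompl ((radicalOn B p W).submoduleOf W)
      let U := U'.map W.subtype
      have hdisj : Disjoint (radicalOn B p W) U := by
        rw [Submodule.disjoint_def]
        rintro x hx ⟨y, hy, rfl⟩
        have := (Submodule.disjoint_def.mp hU'.disjoint) y hx hy
        simp [this]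
      have hsup : radicalOn B p W ⊔ U = W := by
        have h1 := congrArg (Submodule.map W.subtype) hU'.sup_eq_top
        rw [Submodule.map_sup, Submodule.map_subtype_top] at h1
        have h2 : ((radicalOn B p W).submoduleOf W).map W.subtype = radicalOn B p W := by
          rw [Submodule.submoduleOf, Submodule.map_comap_subtype]
          exact inf_eq_right.mpr (radicalOn_le B p W)
        rw [h2] at h1
        exact h1
      have hUR : Module.finrank k U = R := by
        have h1 := Submodule.finrank_sup_add_finrank_inf_eq (radicalOn B p W) U
        rw [hsup, hdisj.eq_bot, finrank_bot] at h1
        omega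
      let e : Module.Basis (Fin R) k U := Module.finBasisOfFinrankEq k U hUR
      have hUW : U ≤ W := by rw [← hsup]; exact le_sup_right
      have hdet := det_gram_ne_zero B hB p W U hdisj hsup e
      have hgrad : ∀ v ∈ radicalOn B p W, ∀ w ∈ radicalOn B p W,
          (Matrix.of fun i j => p ⬝ᵥ B (e i) (e j)).det • B v w ∈ S := by
        intro v hv w hw
        obtain ⟨G, hG1, hG2, hG3⟩ := MvPolynomial.exists_gradient_eq B p (fun i => (e i : V)) v w
          (fun i => by rw [hB]; exact hw.2 _ (hUW (e i).2)) (fun i => hv.2 _ (hUW (e i).2))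
          (hv.2 _ hw.1)
        refine ⟨G, by simpa using hG1, fun p' hp' => ?_, hG3.symm⟩
        rw [hG2]
        have h3 := ((hZ p').mp hp').2
        apply det_gram_eq_zero_of_finrank_lt B p' W
        · rintro (i | i)
          · exact hUW (e i).2
          · exact hv.1
        · rintro (i | i)
          · exact hUW (e i).2
          · exact hw.1
        · rw [← hm, Fintype.card_sum, Fintype.card_fin, Fintype.card_unit]; omega
      have hT' := hrad p hp T fun c hc x hx y hy => by
        have := hT c hc _ (hgrad x hx y hy)
        rw [dotProduct_smul, smul_eq_mul] at this
        exact (mul_eq_zero.mp this).resolve_left hdet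
      have hTr : Module.finrank k T ≤ r := by
        rw [hr, ← Module.finrank_fintype_fun_eq_card k]; exact Submodule.finrank_le T
      have : Module.finrank k T ≤ d := le_min (by omega) hTr
      omega)
  obtain ⟨q, hq⟩ : ∃ q, q = Fintype.card k := ⟨_, rfl⟩
  have hq0 : 1 < q := by rw [hq]; exact Fintype.one_lt_card
  rw [← hq, ← hr] at hcard
  rw [← hq]
  have hC : (r * (R + 1) + 1) ^ r ≤ (N * (N + 1) + 1) ^ N := by
    have h1 : r ≤ N := by omega
    have h2 : R ≤ N := by omega
    calc (r * (R + 1) + 1) ^ r ≤ (N * (N + 1) + 1) ^ r := by gcongr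
      _ ≤ _ := Nat.pow_le_pow_right (by omega) h1
  have hcard' := hcard.trans (Nat.mul_le_mul_right _ hC)
  have hd : 2 * d + 1 + m ≤ n + R := by
    have : d ≤ (n - m + R - 1) / 2 := min_le_left _ _
    omega
  calc Z.card ^ 2 * q * q ^ m ≤ ((N * (N + 1) + 1) ^ N * q ^ d) ^ 2 * q * q ^ m := by gcongr
    _ = ((N * (N + 1) + 1) ^ N) ^ 2 * q ^ (2 * d + 1 + m) := by ring
    _ ≤ _ := by gcongr; omega

theorem AddChar.norm_sum_sq_le {k W : Type*} [Field k] [Fintype k] [AddCommGroup W]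
    [Module k W] [Fintype W] (h2 : (2 : k) ≠ 0) (ψ : AddChar k ℂ) (hψ : ψ ≠ 1)
    (b : W →ₗ[k] W →ₗ[k] k) (hb : ∀ x y, b x y = b y x) :
    ‖∑ x, ψ (b x x)‖ ^ 2 ≤ Fintype.card W * Nat.card {x : W // ∀ y, b x y = 0} := by
  classical
  have hinner : ∀ h, ∑ y, ψ (2 * b h y) =
      if ∀ y, b h y = 0 then (Fintype.card W : ℂ) else 0 := by
    intro h
    split_ifs with hh
    · simp [hh]
    · push Not at hh
      obtain ⟨y, hy⟩ := hh
      let χ : AddChar W ℂ := ψ.compAddMonoidHom ((2 : k) • b h : W →ₗ[k] k).toAddMonoidHom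
      have hχ : χ ≠ 0 := by
        intro h0
        have hprim := AddChar.IsPrimitive.of_ne_one hψ
        refine hprim (a := 2 * b h y) (mul_ne_zero h2 hy) ?_
        ext t
        have := DFunLike.congr_fun h0 (t • y)
        simp only [χ, AddChar.compAddMonoidHom_apply, AddChar.zero_apply] at this
        rw [AddChar.mulShift_apply, AddChar.one_apply, ← this]
        congr 1
        simp
        ring
      exact AddChar.sum_eq_zero_iff_ne_zero.mpr hχ
  have hsq : ((‖∑ x, ψ (b x x)‖ ^ 2 : ℝ) : ℂ) =
      ∑ h, ψ (b h h) * (if ∀ y, b h y = 0 then (Fintype.card W : ℂ) else 0) := by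
    push_cast
    rw [← Complex.mul_conj', map_sum, Finset.sum_mul_sum, Finset.sum_comm]
    simp only [← AddChar.map_neg_eq_conj, ← AddChar.map_add_eq_mul, ← hinner, Finset.mul_sum]
    rw [Finset.sum_comm (s := Finset.univ) (t := Finset.univ)
      (f := fun h y => ψ (b h h + 2 * b h y))]
    refine Finset.sum_congr rfl fun y _ => ?_
    refine Fintype.sum_equiv (Equiv.subRight y) _ _ fun x => ?_
    congr 1
    simp only [Equiv.subRight_apply, map_sub, LinearMap.sub_apply, hb y x]
    ring
  have hnorm := congrArg norm hsq
  rw [Complex.norm_real, Real.norm_of_nonneg (by positivity)] at hnorm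
  rw [hnorm]
  refine (norm_sum_le _ _).trans ?_
  rw [Nat.card_eq_fintype_card, Fintype.card_subtype, mul_comm, ← nsmul_eq_mul,
    ← Finset.sum_const, Finset.sum_filter]
  refine Finset.sum_le_sum fun h _ => ?_
  rw [norm_mul, AddChar.norm_apply, one_mul]
  split_ifs <;> simp

/-- The number of zeros on `W` of a system of quadratic forms. -/
noncomputable def zerosCard {k κ V : Type*} [Field k] [AddCommGroup V] [Module k V]
    (B : V →ₗ[k] V →ₗ[k] κ → k) (W : Submodule k V) : ℕ :=
  Nat.card {x : W // B x x = 0}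

theorem card_pow_mul_zerosCard {k κ V : Type*} [Field k] [Fintype k] [Fintype κ] [DecidableEq κ]
    [AddCommGroup V] [Module k V] (B : V →ₗ[k] V →ₗ[k] κ → k) (W : Submodule k V) [Fintype W]
    (ψ : AddChar k ℂ) (hψ : ψ ≠ 1) :
    ((Fintype.card k : ℂ) ^ Fintype.card κ * zerosCard B W) =
      ∑ c : κ → k, ∑ x : W, ψ (c ⬝ᵥ B x x) := by
  classical
  rw [Finset.sum_comm]
  have hx : ∀ a : κ → k, ∑ c : κ → k, ψ (c ⬝ᵥ a) =
      if a = 0 then (Fintype.card k : ℂ) ^ Fintype.card κ else 0 := by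
    intro a
    have h1 : ∀ c : κ → k, ψ (c ⬝ᵥ a) = ∏ i, ψ (c i * a i) := fun c => by
      exact map_prod ψ.toMonoidHom (fun i => Multiplicative.ofAdd (c i * a i)) Finset.univ
    simp only [h1]
    rw [← Fintype.prod_sum (fun i t => ψ (t * a i))]
    simp only [AddChar.sum_mulShift _ (AddChar.IsPrimitive.of_ne_one hψ)]
    split_ifs with h0
    · simp [h0]
    · obtain ⟨i, hi⟩ := Function.ne_iff.mp h0
      exact Finset.prod_eq_zero (Finset.mem_univ i) (by simpa using hi)
  simp only [hx]
  rw [zerosCard, Nat.card_eq_fintype_card, Fintype.card_subtype, ← Finset.sum_filter,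
    Finset.sum_const, nsmul_eq_mul, mul_comm]

theorem zerosCard_sub_le {k κ V : Type*} [Field k] [Fintype k] [Fintype κ] [AddCommGroup V]
    [Module k V] [FiniteDimensional k V] (h2 : (2 : k) ≠ 0) (B : V →ₗ[k] V →ₗ[k] κ → k)
    (hB : ∀ x y, B x y = B y x) (N C₁ : ℕ) (W : Submodule k V) (hN : Module.finrank k V ≤ N)
    (hstrat : ∀ (R : ℕ) (Z : Finset (κ → k)),
      (∀ c, c ∈ Z ↔ c ≠ 0 ∧ Module.finrank k (radicalOn B c W) + R = Module.finrank k W) →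
      Z.card ^ 2 * Fintype.card k * Fintype.card k ^ Module.finrank k W ≤
        C₁ ^ 2 * Fintype.card k ^ (Module.finrank k V + R)) :
    |(Fintype.card k : ℝ) ^ Fintype.card κ * zerosCard B W -
      (Fintype.card k : ℝ) ^ Module.finrank k W| * √(Fintype.card k) ≤
      ((N + 1) * C₁ : ℕ) * √(Fintype.card k) ^ (Module.finrank k V + Module.finrank k W) := by
  classical
  have : Finite V := Module.finite_of_finite k
  have : Fintype V := Fintype.ofFinite V
  have : Fintype W := Fintype.ofFinite W
  obtain ⟨ψ, hψ⟩ : ∃ ψ : AddChar k ℂ, ψ ≠ 1 := by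
    obtain ⟨ψ, hψ⟩ := (AddChar.exists_apply_ne_zero (α := k) (a := 1)).mpr one_ne_zero
    exact ⟨ψ, fun h => hψ (by rw [h]; rfl)⟩
  obtain ⟨q, hq⟩ : ∃ q : ℝ, q = Fintype.card k := ⟨_, rfl⟩
  obtain ⟨z, hz⟩ : ∃ z : ℝ, z = √(Fintype.card k) := ⟨_, rfl⟩
  have hqz : q = z ^ 2 := by rw [hq, hz, Real.sq_sqrt (by positivity)]
  have hz0 : 0 < z := by rw [hz]; exact Real.sqrt_pos.mpr (by exact_mod_cast Fintype.card_pos)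
  have hz1 : 1 ≤ z := by
    rw [hz, Real.one_le_sqrt]; exact_mod_cast Fintype.card_pos
  obtain ⟨m, hm⟩ : ∃ m, m = Module.finrank k W := ⟨_, rfl⟩
  obtain ⟨n, hn⟩ : ∃ n, n = Module.finrank k V := ⟨_, rfl⟩
  have hmn : m ≤ n := by rw [hm, hn]; exact Submodule.finrank_le W
  have hWcard : (Fintype.card W : ℝ) = q ^ m := by
    rw [Module.card_eq_pow_finrank (K := k), Nat.cast_pow, hq, hm]
  let S : (κ → k) → ℂ := fun c => ∑ x : W, ψ (c ⬝ᵥ B x x)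
  have hS : ∀ c, ‖S c‖ ^ 2 ≤ q ^ m * q ^ Module.finrank k (radicalOn B c W) := by
    intro c
    let b : W →ₗ[k] W →ₗ[k] k := LinearMap.mk₂ k (fun x y => c ⬝ᵥ B x y)
      (fun x y w => by simp) (fun a x w => by simp) (fun x y w => by simp) (fun a x w => by simp)
    refine (AddChar.norm_sum_sq_le h2 ψ hψ b (fun x y => by simp [b, hB (x : V) y])).trans ?_
    rw [hWcard]
    refine mul_le_mul_of_nonneg_left (le_of_eq ?_) (by rw [hqz]; positivity)
    rw [hq, ← Nat.cast_pow, ← Nat.card_eq_fintype_card (α := k), ← Module.natCard_eq_pow_finrank]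
    congr 1
    refine Nat.card_congr ⟨fun x => ⟨x.1, x.1.2, fun y hy => x.2 ⟨y, hy⟩⟩,
      fun x => ⟨⟨x.1, x.2.1⟩, fun y => x.2.2 y y.2⟩, fun x => rfl, fun x => rfl⟩
  have hmain := card_pow_mul_zerosCard B W ψ hψ
  rw [← Finset.add_sum_erase _ _ (Finset.mem_univ (0 : κ → k))] at hmain
  simp only [zero_dotProduct, AddChar.map_zero_eq_one, Finset.sum_const, Finset.card_univ,
    nsmul_eq_mul, mul_one] at hmain
  have herr : |q ^ Fintype.card κ * zerosCard B W - q ^ m| ≤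
      ∑ c ∈ Finset.univ.erase (0 : κ → k), ‖S c‖ := by
    refine le_trans (le_of_eq ?_) (norm_sum_le _ _)
    rw [← Real.norm_eq_abs, ← Complex.norm_real, ← hWcard, hq]
    congr 1
    push_cast
    exact sub_eq_iff_eq_add'.mpr hmain
  let ρ : (κ → k) → ℕ := fun c => m - Module.finrank k (radicalOn B c W)
  have hρ : ∀ c, Module.finrank k (radicalOn B c W) + ρ c = m := fun c =>
    Nat.add_sub_cancel' (by rw [hm]; exact Submodule.finrank_mono (radicalOn_le B c W))
  rw [← Finset.sum_fiberwise_of_maps_to (g := ρ) (t := Finset.range (m + 1))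
    (fun c _ => Finset.mem_range.mpr (by have := hρ c; omega))] at herr
  have hR : ∀ R ∈ Finset.range (m + 1), (∑ c ∈ (Finset.univ.erase (0 : κ → k)).filter
      (fun c => ρ c = R), ‖S c‖) * z ≤ C₁ * z ^ (n + m) := by
    intro R _
    set Z := (Finset.univ.erase (0 : κ → k)).filter (fun c => ρ c = R) with hZ
    have hs := hstrat R Z (fun c => by
      rw [hZ, Finset.mem_filter, Finset.mem_erase, ← hm]
      have := hρ c
      constructor
      · rintro ⟨⟨h1, -⟩, h2⟩; exact ⟨h1, by omega⟩
      · rintro ⟨h1, h2⟩; exact ⟨⟨h1, Finset.mem_univ _⟩, by omega⟩)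
    have hs' : ((Z.card : ℝ) * z * z ^ m) ^ 2 ≤ (C₁ * z ^ (n + R)) ^ 2 := by
      have : (Z.card : ℝ) ^ 2 * q * q ^ m ≤ (C₁ : ℝ) ^ 2 * q ^ (n + R) := by
        rw [hq, hm, hn]; exact_mod_cast hs
      rw [hqz] at this
      calc _ = (Z.card : ℝ) ^ 2 * z ^ 2 * (z ^ 2) ^ m := by ring
        _ ≤ _ := this
        _ = _ := by ring
    have hs2 := (pow_le_pow_iff_left₀
      (mul_nonneg (mul_nonneg (Nat.cast_nonneg _) hz0.le) (pow_nonneg hz0.le _))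
      (mul_nonneg (Nat.cast_nonneg _) (pow_nonneg hz0.le _)) two_ne_zero).mp hs'
    have hSc : ∀ c ∈ Z, ‖S c‖ * z ^ R ≤ z ^ m * z ^ m := by
      intro c hc
      have hcR : ρ c = R := (Finset.mem_filter.mp hc).2
      have h1 := hρ c
      rw [hcR] at h1
      refine (pow_le_pow_iff_left₀ (by positivity) (by positivity) two_ne_zero).mp ?_
      calc (‖S c‖ * z ^ R) ^ 2 = ‖S c‖ ^ 2 * q ^ R := by rw [hqz]; ring
        _ ≤ q ^ m * q ^ Module.finrank k (radicalOn B c W) * q ^ R :=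
            mul_le_mul_of_nonneg_right (hS c) (by rw [hqz]; positivity)
        _ = q ^ m * q ^ m := by rw [mul_assoc, ← pow_add, h1]
        _ = _ := by rw [hqz]; ring
    refine le_of_mul_le_mul_right ?_ (pow_pos hz0 R)
    calc (∑ c ∈ Z, ‖S c‖) * z * z ^ R = (∑ c ∈ Z, ‖S c‖ * z ^ R) * z := by
          rw [← Finset.sum_mul]; ring
      _ ≤ (Z.card • (z ^ m * z ^ m)) * z := by
          gcongr; exact Finset.sum_le_card_nsmul _ _ _ hSc
      _ = (Z.card * z * z ^ m) * z ^ m := by rw [nsmul_eq_mul]; ring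
      _ ≤ (C₁ * z ^ (n + R)) * z ^ m := by gcongr
      _ = _ := by ring
  have hfin : (∑ R ∈ Finset.range (m + 1), ∑ c ∈ (Finset.univ.erase (0 : κ → k)).filter
      (fun c => ρ c = R), ‖S c‖) * z ≤ (N + 1 : ℕ) * (C₁ * z ^ (n + m)) := by
    rw [Finset.sum_mul]
    refine (Finset.sum_le_card_nsmul _ _ _ hR).trans ?_
    rw [Finset.card_range, nsmul_eq_mul]
    have : m + 1 ≤ N + 1 := by omega
    gcongr
  rw [← hz, ← hq, ← hm, ← hn]
  calc _ ≤ _ := mul_le_mul_of_nonneg_right herr hz0.le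
    _ ≤ _ := hfin
    _ = _ := by push_cast; ring

/-- Over a sufficiently large finite field, a linear system of quadratic forms without large
common isotropic subspaces has a nonsingular zero. -/
theorem exists_nonsingular_zero {k κ V : Type*} [Field k] [Fintype k] [Fintype κ] [AddCommGroup V]
    [Module k V] [FiniteDimensional k V] (h2 : (2 : k) ≠ 0) (B : V →ₗ[k] V →ₗ[k] κ → k)
    (hB : ∀ x y, B x y = B y x)
    (hstar : ∀ (C : Submodule k (κ → k)) (W : Submodule k V),
      (∀ c ∈ C, ∀ x ∈ W, ∀ y ∈ W, c ⬝ᵥ B x y = 0) →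
      Module.finrank k V * Module.finrank k C + 2 * Fintype.card κ * Module.finrank k W ≤
        2 * Fintype.card κ * Module.finrank k V)
    (hn : 4 * Fintype.card κ < Module.finrank k V) (N : ℕ) (hN : Module.finrank k V ≤ N)
    (hq : 4 * (1 + (N + 1) * (N * (N + 1) + 1) ^ N) ^ 2 ≤ Fintype.card k) :
    ∃ x, B x x = 0 ∧ ∀ c : κ → k, c ≠ 0 → ∃ y, c ⬝ᵥ B x y ≠ 0 := by
  classical
  by_contra! hsing
  have hstrat := card_rank_stratum_le B hB hstar hn N hN
  obtain ⟨C₁, hC₁⟩ : ∃ C₁, C₁ = (N * (N + 1) + 1) ^ N := ⟨_, rfl⟩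
  rw [← hC₁] at hq
  simp only [← hC₁] at hstrat
  have hcount := fun W => zerosCard_sub_le h2 B hB N C₁ W hN (hstrat W)
  obtain ⟨C₂, hC₂⟩ : ∃ C₂ : ℝ, C₂ = ((N + 1) * C₁ : ℕ) := ⟨_, rfl⟩
  simp only [← hC₂] at hcount
  have hC₂0 : 0 ≤ C₂ := by rw [hC₂]; positivity
  have : Finite V := Module.finite_of_finite k
  have : Fintype V := Fintype.ofFinite V
  obtain ⟨q, hqd⟩ : ∃ q : ℝ, q = Fintype.card k := ⟨_, rfl⟩
  obtain ⟨z, hz⟩ : ∃ z : ℝ, z = √q := ⟨_, rfl⟩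
  have hqz : q = z ^ 2 := by rw [hz, Real.sq_sqrt (by rw [hqd]; positivity)]
  have hz0 : 0 < z := by rw [hz, hqd]; exact Real.sqrt_pos.mpr (by exact_mod_cast Fintype.card_pos)
  have hz1 : 1 ≤ z := by
    rw [hz, hqd, Real.one_le_sqrt]; exact_mod_cast Fintype.card_pos
  have hzbig : 2 * (1 + C₂) ≤ z := by
    rw [hz, hqd]
    refine Real.le_sqrt_of_sq_le ?_
    have : ((4 * (1 + (N + 1) * C₁) ^ 2 : ℕ) : ℝ) ≤ Fintype.card k := by exact_mod_cast hq
    refine le_trans (le_of_eq ?_) this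
    rw [hC₂]; push_cast; ring
  obtain ⟨n, hnd⟩ : ∃ n, n = Module.finrank k V := ⟨_, rfl⟩
  obtain ⟨r, hr⟩ : ∃ r, r = Fintype.card κ := ⟨_, rfl⟩
  rw [← hnd, ← hr] at hn
  simp only [← hz, ← hqd, ← hnd, ← hr] at hcount hstar hN
  have hq0 : 0 < q := by rw [hqz]; positivity
  let W : (κ → k) → Submodule k V := fun c => radicalOn B c ⊤
  let ρ : (κ → k) → ℕ := fun c => n - Module.finrank k (W c)
  have hρ : ∀ c, Module.finrank k (W c) + ρ c = n := fun c =>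
    Nat.add_sub_cancel' (by rw [hnd]; exact Submodule.finrank_le (W c))
  have hρ1 : ∀ c ≠ 0, 1 ≤ ρ c := by
    intro c hc
    by_contra! h0
    have h1 := hρ c
    have h2 : W c = ⊤ := Submodule.eq_top_of_finrank_eq (by omega)
    have h3 := hstar (Submodule.span k {c}) (W c) (fun c' hc' x hx y hy => by
      obtain ⟨a, rfl⟩ := Submodule.mem_span_singleton.mp hc'
      rw [smul_dotProduct, hx.2 y trivial, smul_zero])
    rw [finrank_span_singleton hc] at h3
    have h4 : Module.finrank k (W c) = n := by omega
    rw [h4] at h3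
    omega
  have hle : zerosCard B (⊤ : Submodule k V) ≤
      ∑ c ∈ Finset.univ.erase (0 : κ → k), zerosCard B (W c) := by
    have h1 : (Finset.univ.filter fun x : V => B x x = 0) ⊆
        (Finset.univ.erase (0 : κ → k)).biUnion fun c =>
          Finset.univ.filter fun x : V => x ∈ W c ∧ B x x = 0 := by
      intro x hx
      have hx' := (Finset.mem_filter.mp hx).2
      obtain ⟨c, hc, h⟩ := hsing x hx'
      simp only [Finset.mem_biUnion, Finset.mem_erase, Finset.mem_filter, Finset.mem_univ, true_and,
        and_true]
      exact ⟨c, hc, ⟨trivial, fun y _ => h y⟩, hx'⟩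
    have h2 : ∀ W : Submodule k V, zerosCard B W =
        (Finset.univ.filter fun x : V => x ∈ W ∧ B x x = 0).card := by
      intro W
      rw [zerosCard, ← Fintype.card_subtype, ← Nat.card_eq_fintype_card]
      exact Nat.card_congr (Equiv.subtypeSubtypeEquivSubtypeInter (· ∈ W) (fun x => B x x = 0))
    have h3 := (Finset.card_le_card h1).trans Finset.card_biUnion_le
    simp only [h2, Submodule.mem_top, true_and]
    exact h3
  rw [← Finset.sum_fiberwise_of_maps_to (g := ρ) (t := Finset.range (n + 1))
    (fun c _ => Finset.mem_range.mpr (by have := hρ c; omega))] at hle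
  have hR : ∀ R ∈ Finset.range (n + 1), q ^ r * (∑ c ∈ (Finset.univ.erase (0 : κ → k)).filter
      (fun c => ρ c = R), (zerosCard B (W c) : ℝ)) * q ≤ C₁ * (1 + C₂) * z ^ (2 * n) := by
    intro R _
    set Z := (Finset.univ.erase (0 : κ → k)).filter (fun c => ρ c = R) with hZ
    have hs := hstrat ⊤ R Z (fun c => by
      rw [hZ, Finset.mem_filter, Finset.mem_erase, finrank_top, ← hnd]
      have : Module.finrank k (radicalOn B c ⊤) + ρ c = n := hρ c
      constructor
      · rintro ⟨⟨h1, -⟩, h2⟩; exact ⟨h1, by omega⟩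
      · rintro ⟨h1, h2⟩; exact ⟨⟨h1, Finset.mem_univ _⟩, by omega⟩)
    have hs' : ((Z.card : ℝ) * z) ^ 2 ≤ (C₁ * z ^ R) ^ 2 := by
      have : (Z.card : ℝ) ^ 2 * q * q ^ n ≤ (C₁ : ℝ) ^ 2 * q ^ (n + R) := by
        rw [hqd, hnd]; rw [finrank_top] at hs; exact_mod_cast hs
      refine le_of_mul_le_mul_right ?_ (pow_pos hq0 n)
      calc _ = (Z.card : ℝ) ^ 2 * q * q ^ n := by rw [hqz]; ring
        _ ≤ _ := this
        _ = _ := by rw [hqz]; ring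
    have hs2 := (pow_le_pow_iff_left₀
      (mul_nonneg (Nat.cast_nonneg _) hz0.le)
      (mul_nonneg (Nat.cast_nonneg _) (pow_nonneg hz0.le _)) two_ne_zero).mp hs'
    have hSc : ∀ c ∈ Z, q ^ r * (zerosCard B (W c) : ℝ) * z * z ^ R ≤ (1 + C₂) * z ^ (2 * n) := by
      intro c hc
      have hc' := Finset.mem_filter.mp hc
      have h1 := hρ c
      have h2 := hρ1 c (Finset.mem_erase.mp hc'.1).1
      rw [hc'.2] at h1 h2
      have h3 := hcount (W c)
      obtain ⟨m, hm⟩ : ∃ m, m = Module.finrank k (W c) := ⟨_, rfl⟩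
      rw [← hm] at h3 h1
      have h4 := (mul_le_mul_of_nonneg_right (le_abs_self _) hz0.le).trans h3
      have h5 : q ^ m * z * z ^ R ≤ z ^ (2 * n) := by
        have : q ^ m * z * z ^ R = z ^ (2 * m + 1 + R) := by rw [hqz]; ring
        rw [this]
        exact pow_le_pow_right₀ hz1 (by omega)
      have h6 : C₂ * z ^ (n + m) * z ^ R = C₂ * z ^ (2 * n) := by
        rw [mul_assoc, ← pow_add]; congr 2; omega
      nlinarith [mul_le_mul_of_nonneg_right h4 (pow_nonneg hz0.le R)]
    refine le_of_mul_le_mul_right ?_ (pow_pos hz0 R)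
    calc q ^ r * (∑ c ∈ Z, (zerosCard B (W c) : ℝ)) * q * z ^ R =
          (∑ c ∈ Z, q ^ r * (zerosCard B (W c) : ℝ) * z * z ^ R) * z := by
          rw [← Finset.sum_mul, ← Finset.sum_mul, ← Finset.mul_sum, hqz]; ring
      _ ≤ (Z.card • ((1 + C₂) * z ^ (2 * n))) * z := by
          gcongr; exact Finset.sum_le_card_nsmul _ _ _ hSc
      _ = (Z.card * z) * ((1 + C₂) * z ^ (2 * n)) := by rw [nsmul_eq_mul]; ring
      _ ≤ (C₁ * z ^ R) * ((1 + C₂) * z ^ (2 * n)) := by gcongr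
      _ = _ := by ring
  have hsum : q ^ r * (zerosCard B (⊤ : Submodule k V) : ℝ) * q ≤ C₂ * (1 + C₂) * z ^ (2 * n) := by
    have h1 : (zerosCard B (⊤ : Submodule k V) : ℝ) ≤ ∑ R ∈ Finset.range (n + 1),
        ∑ c ∈ (Finset.univ.erase (0 : κ → k)).filter (fun c => ρ c = R),
          (zerosCard B (W c) : ℝ) := by exact_mod_cast hle
    calc _ ≤ q ^ r * (∑ R ∈ Finset.range (n + 1),
        ∑ c ∈ (Finset.univ.erase (0 : κ → k)).filter (fun c => ρ c = R),
          (zerosCard B (W c) : ℝ)) * q := by gcongr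
      _ = ∑ R ∈ Finset.range (n + 1), q ^ r *
        (∑ c ∈ (Finset.univ.erase (0 : κ → k)).filter (fun c => ρ c = R),
          (zerosCard B (W c) : ℝ)) * q := by rw [← Finset.sum_mul, ← Finset.mul_sum]
      _ ≤ _ := Finset.sum_le_card_nsmul _ _ _ hR
      _ = (n + 1 : ℕ) * (C₁ * (1 + C₂) * z ^ (2 * n)) := by rw [Finset.card_range, nsmul_eq_mul]
      _ ≤ (N + 1 : ℕ) * (C₁ * (1 + C₂) * z ^ (2 * n)) := by
          have : n + 1 ≤ N + 1 := by omega
          gcongr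
      _ = _ := by rw [hC₂]; push_cast; ring
  have htop := hcount ⊤
  rw [finrank_top, ← hnd] at htop
  have h4 := (mul_le_mul_of_nonneg_right (neg_le_abs _) hz0.le).trans htop
  have h5 : q ^ n = z ^ (2 * n) := by rw [hqz]; ring
  have h6 : z ^ (n + n) = z ^ (2 * n) := by ring
  rw [h5, h6] at h4
  have h7 : z ^ (2 * n) * (z * (z - C₂)) ≤ z ^ (2 * n) * (C₂ * (1 + C₂)) := by
    have h8 := mul_le_mul_of_nonneg_right h4 hz0.le
    rw [hqz] at hsum h8
    nlinarith
  have h8 := le_of_mul_le_mul_left h7 (pow_pos hz0 _)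
  nlinarith

open scoped Matrix in
/-- Smith normal form of a nonsingular square matrix over a discrete valuation ring. -/
theorem Matrix.exists_eq_mul_diagonal_pow_mul {O ι : Type*} [CommRing O] [IsDomain O]
    [IsDiscreteValuationRing O] [Fintype ι] [DecidableEq ι] {π : O} (hπ : Irreducible π)
    (T : Matrix ι ι O) (hT : T.det ≠ 0) :
    ∃ (P Q : Matrix ι ι O) (t : ι → ℕ), IsUnit P.det ∧ IsUnit Q.det ∧
      T = P * Matrix.diagonal (fun i => π ^ t i) * Q := by
  classical
  have hinj : Function.Injective T.mulVecLin := by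
    rw [← LinearMap.ker_eq_bot, LinearMap.ker_eq_bot']
    intro v hv
    by_contra hv0
    exact hT (Matrix.exists_mulVec_eq_zero_iff.mp ⟨v, hv0, hv⟩)
  have hrank : Module.finrank O (LinearMap.range T.mulVecLin) = Module.finrank O (ι → O) :=
    LinearMap.finrank_range_of_inj hinj
  obtain ⟨b', a, ab', hab⟩ :=
    Submodule.exists_smith_normal_form_of_rank_eq (Pi.basisFun O ι) hrank
  let P : Matrix ι ι O := (Pi.basisFun O ι).toMatrix b'
  have hP : IsUnit P.det := by
    have := (Pi.basisFun O ι).invertibleToMatrix b'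
    exact Matrix.isUnit_det_of_invertible P
  have hPa : ∀ i, (P * Matrix.diagonal a).col i = (ab' i : ι → O) := by
    intro i
    rw [hab i]
    ext j
    simp [P, Module.Basis.toMatrix_apply, mul_comm]
  have h1 : ∀ i, ∃ r, T *ᵥ r = (P * Matrix.diagonal a).col i := by
    intro i
    rw [hPa i]
    obtain ⟨r, hr⟩ := (ab' i).2
    exact ⟨r, hr⟩
  choose r hr using h1
  let R : Matrix ι ι O := Matrix.of fun j i => r i j
  have hR : T * R = P * Matrix.diagonal a := by
    ext j i
    exact congrFun (hr i) j
  let Q : Matrix ι ι O := Matrix.of fun j i =>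
    ab'.repr ⟨T *ᵥ Pi.single i 1, ⟨_, rfl⟩⟩ j
  have hQ : P * Matrix.diagonal a * Q = T := by
    ext j i
    have h2 := congrArg (fun v : LinearMap.range T.mulVecLin => (v : ι → O) j)
      (ab'.sum_repr ⟨T *ᵥ Pi.single i 1, ⟨_, rfl⟩⟩)
    simp only [Matrix.mulVec_single_one, Matrix.col_apply] at h2
    rw [← h2, Matrix.mul_apply]
    rw [AddSubmonoidClass.coe_finsetSum, Finset.sum_apply]
    refine Finset.sum_congr rfl fun l _ => ?_
    have := congrFun (hPa l) j
    rw [Matrix.col_apply] at this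
    rw [this, SetLike.val_smul, Pi.smul_apply, smul_eq_mul, mul_comm]
    simp only [Q, Matrix.of_apply, Matrix.mulVec_single_one]
  have hRQ : R * Q = 1 := by
    have h3 : T * (R * Q) = T * 1 := by rw [← Matrix.mul_assoc, hR, hQ, Matrix.mul_one]
    ext j i
    have h4 : T *ᵥ (R * Q).col i = T *ᵥ (1 : Matrix ι ι O).col i := by
      ext l
      exact congrFun (congrFun h3 l) i
    exact congrFun (hinj h4) j
  have hQu : IsUnit Q.det := by
    refine IsUnit.of_mul_eq_one R.det ?_
    rw [mul_comm, ← Matrix.det_mul, hRQ, Matrix.det_one]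
  have ha : ∀ i, a i ≠ 0 := by
    intro i hi
    refine hT ?_
    rw [← hQ, Matrix.det_mul, Matrix.det_mul, Matrix.det_diagonal,
      Finset.prod_eq_zero (Finset.mem_univ i) hi, mul_zero, zero_mul]
  choose t u htu using fun i =>
    IsDiscreteValuationRing.eq_unit_mul_pow_irreducible (ha i) hπ
  refine ⟨P, Matrix.diagonal (fun i => (u i : O)) * Q, t, hP, ?_, ?_⟩
  · rw [Matrix.det_mul, Matrix.det_diagonal]
    exact (IsUnit.prod_univ_iff.mpr fun i => (u i).isUnit).mul hQu
  · rw [← Matrix.mul_assoc, Matrix.mul_assoc P, Matrix.diagonal_mul_diagonal]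
    conv_lhs => rw [← hQ]
    congr 3
    ext i
    rw [htu i, mul_comm]

theorem LinearMap.apply_apply_eq_sum_single {R ι M : Type*} [CommRing R] [Fintype ι] [DecidableEq ι]
    [AddCommGroup M] [Module R M] (B : (ι → R) →ₗ[R] (ι → R) →ₗ[R] M) (x y : ι → R) :
    B x y = ∑ j, ∑ l, (x j * y l) • B (Pi.single j 1) (Pi.single l 1) := by
  conv_lhs => rw [pi_eq_sum_univ' x, pi_eq_sum_univ' y]
  simp only [map_sum, LinearMap.sum_apply, map_smul, LinearMap.smul_apply, Finset.smul_sum,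
    smul_smul]
  rw [Finset.sum_comm]
  simp only [mul_comm]

theorem exists_eq_pow_smul_of_ne_zero {O ι : Type*} [CommRing O] [IsDomain O]
    [IsDiscreteValuationRing O] {π : O} (hπ : Irreducible π) {x : ι → O} (hx : x ≠ 0) :
    ∃ (e : ℕ) (y : ι → O), x = π ^ e • y ∧ ¬ ∀ j, π ∣ y j := by
  classical
  obtain ⟨j, hj⟩ := Function.ne_iff.mp hx
  have hex : ∃ e, ¬ ∀ j, π ^ (e + 1) ∣ x j := by
    obtain ⟨e, he⟩ := FiniteMultiplicity.of_not_isUnit hπ.not_isUnit hj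
    exact ⟨e, fun h => he (h j)⟩
  have h1 := Nat.find_spec hex
  have h2 : ∀ j, π ^ Nat.find hex ∣ x j := by
    rcases h : Nat.find hex with _ | e
    · simp
    · have := Nat.find_min hex (m := e) (by omega)
      push Not at this
      exact this
  choose y hy using h2
  refine ⟨Nat.find hex, y, funext hy, fun h => h1 fun j => ?_⟩
  rw [hy j, pow_succ]
  exact mul_dvd_mul_left _ (h j)

/-- The elementary divisors of an integral linear transformation of the forms are bounded in
terms of those of the corresponding transformation of the variables. -/
theorem card_mul_sum_exponents_le {O : Type*} [CommRing O] [IsDomain O]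
    [IsDiscreteValuationRing O] {π : O} (hπ : Irreducible π) {ι κ : Type} [Fintype ι]
    [DecidableEq ι]
    [Fintype κ] (N : ℕ)
    (hsmall : ∀ (ι' κ' : Type) [Fintype ι'] [Fintype κ'], Fintype.card κ' < Fintype.card κ →
      4 * Fintype.card κ' < Fintype.card ι' → Fintype.card ι' ≤ N →
      ∀ B : (ι' → O) →ₗ[O] (ι' → O) →ₗ[O] (κ' → O), (∀ x y, B x y = B y x) →
        ∃ x ≠ 0, B x x = 0)
    (hn : 4 * Fintype.card κ < Fintype.card ι) (hN : Fintype.card ι ≤ N)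
    (B : (ι → O) →ₗ[O] (ι → O) →ₗ[O] (κ → O)) (hB : ∀ x y, B x y = B y x)
    (C : ℕ) (hC : ∀ x, (∀ i, π ^ C ∣ B x x i) → ∀ j, π ∣ x j) (t : ι → ℕ) (u : κ → ℕ)
    (hdiv : ∀ j l i, π ^ u i ∣ π ^ (t j + t l) * B (Pi.single j 1) (Pi.single l 1) i) :
    Fintype.card ι * ∑ i, u i ≤ Fintype.card κ * (2 * ∑ j, t j + Fintype.card ι * C) := by
  classical
  have key : ∀ h : ℕ, Fintype.card ι * (Finset.univ.filter fun i => h ≤ u i).card ≤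
      Fintype.card κ * (Finset.univ.filter fun j => h < 2 * t j + C).card := by
    intro h
    by_cases hs : ∀ i, u i < h
    · rw [Finset.filter_eq_empty_iff.mpr (fun {i} _ => by simpa using hs i)]
      simp
    push Not at hs
    obtain ⟨i₀, hi₀⟩ := hs
    have c1 := Finset.card_filter_add_card_filter_not (s := (Finset.univ : Finset κ))
      (fun i => h ≤ u i)
    have c2 := Finset.card_filter_add_card_filter_not (s := (Finset.univ : Finset ι))
      (fun j => h < 2 * t j + C)
    rw [Finset.card_univ] at c1 c2
    have c3 : (Finset.univ.filter fun j => ¬ h < 2 * t j + C).card ≤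
        4 * (Finset.univ.filter fun i => ¬ h ≤ u i).card := by
      by_contra hlt
      rw [not_le] at hlt
      let J := {j : ι // ¬ h < 2 * t j + C}
      let S := {i : κ // ¬ h ≤ u i}
      have hJ : Fintype.card J = (Finset.univ.filter fun j => ¬ h < 2 * t j + C).card :=
        Fintype.card_subtype _
      have hS : Fintype.card S = (Finset.univ.filter fun i => ¬ h ≤ u i).card :=
        Fintype.card_subtype _
      let E : (J → O) →ₗ[O] (ι → O) := Function.ExtendByZero.linearMap O Subtype.val
      obtain ⟨x, hx0, hx⟩ := hsmall J S
        (Fintype.card_subtype_lt (x := i₀) (by simpa using hi₀)) (by omega)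
        ((Fintype.card_subtype_le _).trans hN)
        ((B.compl₁₂ E E).compr₂ (LinearMap.funLeft O O Subtype.val)) (fun x y => by
          simp [hB (E x) (E y)])
      obtain ⟨e, y, rfl, hy⟩ := exists_eq_pow_smul_of_ne_zero hπ hx0
      have hπe : π ^ e ≠ 0 := pow_ne_zero _ hπ.ne_zero
      refine hy fun j => ?_
      have hEy : ∀ j : J, E y j = y j := fun j =>
        Subtype.val_injective.extend_apply y (0 : ι → O) j
      have hEy0 : ∀ j : ι, h < 2 * t j + C → E y j = 0 := fun j hj =>
        Function.extend_apply' y (0 : ι → O) j (by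
          rintro ⟨a, rfl⟩
          exact a.2 hj)
      rw [← hEy]
      refine hC _ (fun i => ?_) _
      by_cases hi : h ≤ u i
      · rw [LinearMap.apply_apply_eq_sum_single B, Finset.sum_apply]
        refine Finset.dvd_sum fun j _ => ?_
        rw [Finset.sum_apply]
        refine Finset.dvd_sum fun l _ => ?_
        rw [Pi.smul_apply, smul_eq_mul]
        by_cases hj : h < 2 * t j + C
        · rw [hEy0 j hj]; simp
        by_cases hl : h < 2 * t l + C
        · rw [hEy0 l hl]; simp
        refine Dvd.dvd.mul_left ?_ _
        have h4 : π ^ (t j + t l) * π ^ C ∣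
            π ^ (t j + t l) * B (Pi.single j 1) (Pi.single l 1) i := by
          rw [← pow_add]
          exact (pow_dvd_pow π (by omega)).trans (hdiv j l i)
        exact (mul_dvd_mul_iff_left (pow_ne_zero _ hπ.ne_zero)).mp h4
      · have h5 := congrFun hx ⟨i, hi⟩
        simp only [LinearMap.compr₂_apply, LinearMap.compl₁₂_apply, map_smul,
          LinearMap.smul_apply, LinearMap.funLeft_apply, Pi.smul_apply, smul_eq_mul,
          Pi.zero_apply, mul_eq_zero, hπe, false_or] at h5
        rw [h5]
        exact dvd_zero _
    obtain ⟨s, hs⟩ : ∃ s, s = (Finset.univ.filter fun i => ¬ h ≤ u i).card := ⟨_, rfl⟩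
    rw [← hs] at c1 c3
    rw [← c1] at hn ⊢
    generalize (Finset.univ.filter fun i => h ≤ u i).card = a at *
    generalize (Finset.univ.filter fun j => h < 2 * t j + C).card = b at *
    generalize Fintype.card ι = n at *
    nlinarith
  have layer : ∀ {α : Type} [Fintype α] (f : α → ℕ) (H : ℕ),
      ∑ h ∈ Finset.Icc 1 H, (Finset.univ.filter fun i => h ≤ f i).card = ∑ i, min (f i) H := by
    intro α _ f H
    simp only [Finset.card_filter]
    rw [Finset.sum_comm]
    refine Finset.sum_congr rfl fun i _ => ?_
    rw [← Finset.card_filter]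
    have : (Finset.Icc 1 H).filter (fun h => h ≤ f i) = Finset.Icc 1 (min (f i) H) := by
      ext; simp; omega
    rw [this, Nat.card_Icc]; omega
  let H := ∑ i, u i
  calc Fintype.card ι * ∑ i, u i
      = Fintype.card ι * ∑ i, min (u i) H := by
        congr 1
        refine Finset.sum_congr rfl fun i _ => (min_eq_left ?_).symm
        exact Finset.single_le_sum (fun _ _ => Nat.zero_le _) (Finset.mem_univ i)
    _ ≤ Fintype.card κ * ∑ j, min (2 * t j + C) H := by
        rw [← layer, ← layer, Finset.mul_sum, Finset.mul_sum]
        refine Finset.sum_le_sum fun h _ => (key h).trans (Nat.mul_le_mul_left _ ?_)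
        exact Finset.card_le_card (Finset.monotone_filter_right _ fun j _ hj => hj.le)
    _ ≤ Fintype.card κ * ∑ j, (2 * t j + C) := by
        gcongr; exact min_le_left _ _
    _ = _ := by
        rw [Finset.sum_add_distrib, ← Finset.mul_sum, Finset.sum_const, Finset.card_univ,
          smul_eq_mul]

theorem LinearMap.exists_apply_single_eq {R ι M : Type*} [CommRing R] [Fintype ι] [DecidableEq ι]
    [AddCommGroup M] [Module R M] (w : ι → ι → M) :
    ∃ B : (ι → R) →ₗ[R] (ι → R) →ₗ[R] M, ∀ j l, B (Pi.single j 1) (Pi.single l 1) = w j l :=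
  ⟨(Pi.basisFun R ι).constr R fun j => (Pi.basisFun R ι).constr R (w j), fun j l => by
    rw [← Pi.basisFun_apply, ← Pi.basisFun_apply, Module.Basis.constr_basis,
      Module.Basis.constr_basis]⟩

theorem LinearMap.exists_map_bilin {R S ι κ : Type*} [CommRing R] [CommRing S] [Fintype ι]
    [DecidableEq ι] (φ : R →+* S) (B : (ι → R) →ₗ[R] (ι → R) →ₗ[R] (κ → R)) :
    ∃ B' : (ι → S) →ₗ[S] (ι → S) →ₗ[S] (κ → S), ∀ x y, B' (φ ∘ x) (φ ∘ y) = φ ∘ B x y := by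
  obtain ⟨B', hB'⟩ := LinearMap.exists_apply_single_eq (R := S) (M := κ → S)
    fun j l : ι => φ ∘ B (Pi.single j 1) (Pi.single l 1)
  refine ⟨B', fun x y => ?_⟩
  rw [LinearMap.apply_apply_eq_sum_single B', LinearMap.apply_apply_eq_sum_single B]
  ext i
  simp [hB', Finset.sum_apply, map_sum]

/-- A nonsingular zero modulo `π` lifts to zeros modulo all powers of `π`. -/
theorem exists_lift_zero_mod_pow {O k ι κ : Type*} [CommRing O] [Field k] (φ : O →+* k) {π : O}
    (hφ : ∀ a, φ a = 0 ↔ π ∣ a) (h2 : (2 : k) ≠ 0)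
    (B : (ι → O) →ₗ[O] (ι → O) →ₗ[O] (κ → O)) (hB : ∀ x y, B x y = B y x) (x₀ : ι → O)
    (h0 : ∀ i, π ∣ B x₀ x₀ i) (hns : ∀ z : κ → k, ∃ y, φ ∘ B x₀ y = z) (m : ℕ) :
    ∃ x, (∀ j, π ∣ x j - x₀ j) ∧ ∀ i, π ^ (m + 1) ∣ B x x i := by
  induction m with
  | zero => exact ⟨x₀, by simp, by simpa using h0⟩
  | succ m ih =>
    obtain ⟨x, hx, hxm⟩ := ih
    choose z hz using hxm
    choose d hd using hx
    obtain ⟨y, hy⟩ := hns fun i => -φ (z i) / 2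
    have hxd : x = x₀ + π • d := by
      ext j; simp [← hd]
    refine ⟨x + π ^ (m + 1) • y, fun j => ?_, fun i => ?_⟩
    · have : (x + π ^ (m + 1) • y) j - x₀ j = π * (d j + π ^ m * y j) := by
        simp only [Pi.add_apply, Pi.smul_apply, smul_eq_mul]
        linear_combination hd j
      exact ⟨_, this⟩
    · have h1 : B (x + π ^ (m + 1) • y) (x + π ^ (m + 1) • y) i =
          π ^ (m + 1) * (z i + 2 * B x y i + π ^ (m + 1) * B y y i) := by
        simp only [map_add, map_smul, LinearMap.add_apply, LinearMap.smul_apply, Pi.add_apply,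
          Pi.smul_apply, smul_eq_mul, hz i, hB y x]
        ring
      rw [h1, pow_succ π (m + 1)]
      refine mul_dvd_mul_left _ ?_
      rw [← hφ, hxd]
      have h3 := congrFun hy i
      have h4 : φ π = 0 := (hφ π).mpr dvd_rfl
      simp only [Function.comp_apply] at h3
      simp only [map_add, map_mul, map_smul, LinearMap.add_apply, LinearMap.smul_apply,
        Pi.add_apply, Pi.smul_apply, smul_eq_mul, h3, map_pow, h4, map_ofNat]
      field_simp
      ring

/-- Every subspace of `kⁿ` is spanned by some of the rows of an invertible matrix, which can be
chosen as the reduction of an invertible integral matrix. -/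
theorem Submodule.exists_isUnit_det_row_mem {O k ι : Type*} [CommRing O] [IsLocalRing O] [Field k]
    [Fintype ι] [DecidableEq ι] (φ : O →+* k) [IsLocalHom φ] (hsurj : Function.Surjective φ)
    (W : Submodule k (ι → k)) :
    ∃ (g : Matrix ι ι O) (A : Finset ι), IsUnit g.det ∧ A.card = Module.finrank k W ∧
      ∀ i ∈ A, φ ∘ g i ∈ W := by
  obtain ⟨W', hW⟩ := W.exists_isCompl
  let b := ((Module.finBasis k W).prod (Module.finBasis k W')).map
    (Submodule.prodEquivOfIsCompl W W' hW)
  have hcard : Fintype.card (Fin (Module.finrank k W) ⊕ Fin (Module.finrank k W')) =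
      Fintype.card ι := by
    rw [← Module.finrank_eq_card_basis b, Module.finrank_fintype_fun_eq_card]
  let e := Fintype.equivOfCardEq hcard
  let v := b.reindex e
  have hv : ∀ s, v (e s) = b s := fun s => by simp [v]
  let G : Matrix ι ι k := Matrix.of fun i => v i
  have hG : G.det ≠ 0 := by
    rw [← isUnit_iff_ne_zero, ← Matrix.isUnit_iff_isUnit_det,
      ← Matrix.linearIndependent_rows_iff_isUnit]
    exact v.linearIndependent
  let g : Matrix ι ι O := Matrix.of fun i j => Function.surjInv hsurj (G i j)
  have hgG : φ.mapMatrix g = G := by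
    ext i j
    exact Function.surjInv_eq hsurj _
  refine ⟨g, (Finset.univ.image fun s : Fin (Module.finrank k W) => e (Sum.inl s)), ?_, ?_, ?_⟩
  · refine isUnit_of_map_unit φ _ ?_
    rw [RingHom.map_det, hgG]
    exact isUnit_iff_ne_zero.mpr hG
  · exact (Finset.card_image_of_injective _ (e.injective.comp Sum.inl_injective)).trans (by simp)
  · intro i hi
    obtain ⟨s, -, rfl⟩ := Finset.mem_image.mp hi
    have : φ ∘ g (e (Sum.inl s)) = v (e (Sum.inl s)) := by
      ext j
      exact congrFun (congrFun hgG (e (Sum.inl s))) j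
    rw [this, hv]
    simp [b]

theorem LinearMap.surjective_of_dotProduct_ne_zero {k κ V : Type*} [Field k] [Fintype κ]
    [AddCommGroup V] [Module k V] (L : V →ₗ[k] κ → k)
    (h : ∀ c : κ → k, c ≠ 0 → ∃ y, c ⬝ᵥ L y ≠ 0) : Function.Surjective L := by
  rw [← LinearMap.range_eq_top]
  obtain ⟨T, hT, hcard⟩ := card_le_finrank_span_add_finrank_orthogonal (Set.range L)
  have hT0 : T = ⊥ := by
    rw [eq_bot_iff]
    intro c hc
    by_contra h0
    obtain ⟨y, hy⟩ := h c h0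
    exact hy (hT c hc _ ⟨y, rfl⟩)
  rw [hT0, finrank_bot, add_zero, ← LinearMap.coe_range, Submodule.span_eq] at hcard
  refine Submodule.eq_top_of_finrank_eq (le_antisymm (Submodule.finrank_le _) ?_)
  simpa using hcard

open scoped Matrix in
/-- A large common isotropic subspace of the reduction of a system of quadratic forms gives rise
to a substitution making the transformed system divisible. -/
theorem exists_transform_of_isotropic {O k ι κ : Type*} [CommRing O] [IsDomain O] [IsLocalRing O]
    [Field k] [Fintype ι] [DecidableEq ι] [Fintype κ] [DecidableEq κ] (φ : O →+* k) [IsLocalHom φ]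
    (hsurj : Function.Surjective φ) {π : O} (hπ : π ≠ 0) (hφ : ∀ a, φ a = 0 ↔ π ∣ a)
    (B : (ι → O) →ₗ[O] (ι → O) →ₗ[O] (κ → O)) (hB : ∀ x y, B x y = B y x)
    (W : Submodule k (ι → k)) (C : Submodule k (κ → k))
    (hCW : ∀ c ∈ C, ∀ x y : ι → O, φ ∘ x ∈ W → φ ∘ y ∈ W → c ⬝ᵥ (φ ∘ B x y) = 0) :
    ∃ (T : Matrix ι ι O) (U : Matrix κ κ O) (B' : (ι → O) →ₗ[O] (ι → O) →ₗ[O] (κ → O)),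
      (∀ x y, B' x y = B' y x) ∧ (∀ x y, B (T *ᵥ x) (T *ᵥ y) = U *ᵥ B' x y) ∧
      Associated T.det (π ^ (Fintype.card ι - Module.finrank k W)) ∧
      Associated U.det (π ^ Module.finrank k C) := by
  obtain ⟨g, A, hg, hA, hgW⟩ := W.exists_isUnit_det_row_mem φ hsurj
  obtain ⟨h, A', hh, hA', hhC⟩ := C.exists_isUnit_det_row_mem φ hsurj
  have hφπ : φ π = 0 := (hφ π).mpr dvd_rfl
  let T : Matrix ι ι O := (Matrix.diagonal (fun j => if j ∈ A then 1 else π) * g)ᵀ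
  let D : κ → O := fun i => if i ∈ A' then π else 1
  let U : Matrix κ κ O := h⁻¹ * Matrix.diagonal D
  have hTdet : Associated T.det (π ^ (Fintype.card ι - Module.finrank k W)) := by
    simp only [T, Matrix.det_transpose, Matrix.det_mul, Matrix.det_diagonal, Finset.prod_ite,
      Finset.prod_const, one_pow, one_mul]
    have h1 : (Finset.univ.filter fun j => j ∉ A).card =
        Fintype.card ι - Module.finrank k W := by
      rw [← hA, ← Finset.card_compl]
      congr 1
      ext; simp
    rw [h1]
    exact associated_mul_unit_left _ _ hg
  have hUdet : Associated U.det (π ^ Module.finrank k C) := by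
    simp only [U, D, Matrix.det_mul, Matrix.det_diagonal, Finset.prod_ite,
      Finset.prod_const, one_pow, mul_one]
    rw [Finset.filter_mem_eq_inter, Finset.univ_inter, hA']
    refine associated_unit_mul_left _ _ ?_
    rw [Matrix.det_nonsing_inv]
    exact hh.ringInverse
  have hTe : ∀ j, T *ᵥ Pi.single j 1 = (if j ∈ A then 1 else π) • g j := by
    intro j
    ext l
    simp only [T, Matrix.mulVec_single_one, Matrix.col_apply, Matrix.transpose_apply,
      Matrix.diagonal_mul, Pi.smul_apply, smul_eq_mul]
  have hTW : ∀ j, φ ∘ (T *ᵥ Pi.single j 1) ∈ W := by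
    intro j
    rw [hTe]
    split_ifs with hj
    · rw [one_smul]; exact hgW j hj
    · convert W.zero_mem
      ext; simp [hφπ]
  have hw : ∀ j l i, ∃ w, (h *ᵥ B (T *ᵥ Pi.single j 1) (T *ᵥ Pi.single l 1)) i = D i * w := by
    intro j l i
    by_cases hi : i ∈ A'
    · simp only [D, if_pos hi]
      change π ∣ _
      rw [← hφ]
      have := hCW _ (hhC i hi) _ _ (hTW j) (hTW l)
      rwa [← RingHom.map_dotProduct] at this
    · exact ⟨_, by simp only [D, if_neg hi, one_mul]; rfl⟩
  choose w hw using hw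
  obtain ⟨B', hB'⟩ := LinearMap.exists_apply_single_eq (R := O) w
  have hBT : ∀ x y, B (T *ᵥ x) (T *ᵥ y) = U *ᵥ B' x y := by
    intro x y
    have h1 := LinearMap.apply_apply_eq_sum_single (B.compl₁₂ T.mulVecLin T.mulVecLin) x y
    have h2 := LinearMap.apply_apply_eq_sum_single (B'.compr₂ U.mulVecLin) x y
    simp only [LinearMap.compl₁₂_apply, LinearMap.compr₂_apply, Matrix.mulVecLin_apply] at h1 h2
    rw [h1, h2]
    refine Finset.sum_congr rfl fun j _ => Finset.sum_congr rfl fun l _ => ?_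
    congr 1
    rw [hB']
    have h3 : Matrix.diagonal D *ᵥ w j l =
        h *ᵥ B (T *ᵥ Pi.single j 1) (T *ᵥ Pi.single l 1) := by
      ext i
      rw [hw, Matrix.mulVec_diagonal]
    simp only [U]
    rw [← Matrix.mulVec_mulVec, h3, Matrix.mulVec_mulVec, Matrix.nonsing_inv_mul _ hh,
      Matrix.one_mulVec]
  refine ⟨T, U, B', fun x y => ?_, hBT, hTdet, hUdet⟩
  have hU0 : U.det ≠ 0 := fun h0 => by
    rw [h0] at hUdet
    exact pow_ne_zero _ hπ ((associated_zero_iff_eq_zero _).mp hUdet.symm)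
  refine sub_eq_zero.mp (Matrix.eq_zero_of_mulVec_eq_zero hU0 ?_)
  rw [Matrix.mulVec_sub, ← hBT, ← hBT, hB, sub_self]

open scoped Matrix in
theorem Matrix.dvd_mulVec {R m n : Type*} [CommRing R] [Fintype n] {a : R} (M : Matrix m n R)
    {v : n → R} (h : ∀ j, a ∣ v j) (i : m) : a ∣ (M *ᵥ v) i :=
  Finset.dvd_sum fun j _ => (h j).mul_left _

open scoped Matrix in
theorem card_mul_exponent_det_le {O : Type*} [CommRing O] [IsDomain O]
    [IsDiscreteValuationRing O] {π : O} (hπ : Irreducible π) {ι κ : Type} [Fintype ι]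
    [DecidableEq ι]
    [Fintype κ] [DecidableEq κ] (N : ℕ)
    (hsmall : ∀ (ι' κ' : Type) [Fintype ι'] [Fintype κ'], Fintype.card κ' < Fintype.card κ →
      4 * Fintype.card κ' < Fintype.card ι' → Fintype.card ι' ≤ N →
      ∀ B : (ι' → O) →ₗ[O] (ι' → O) →ₗ[O] (κ' → O), (∀ x y, B x y = B y x) →
        ∃ x ≠ 0, B x x = 0)
    (hn : 4 * Fintype.card κ < Fintype.card ι) (hN : Fintype.card ι ≤ N)
    (B : (ι → O) →ₗ[O] (ι → O) →ₗ[O] (κ → O)) (hB : ∀ x y, B x y = B y x)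
    (C : ℕ) (hC : ∀ x, (∀ i, π ^ C ∣ B x x i) → ∀ j, π ∣ x j)
    (T : Matrix ι ι O) (U : Matrix κ κ O) (B' : (ι → O) →ₗ[O] (ι → O) →ₗ[O] (κ → O))
    (hTU : ∀ x y, B (T *ᵥ x) (T *ᵥ y) = U *ᵥ B' x y) (a b : ℕ) (hT : Associated T.det (π ^ a))
    (hU : Associated U.det (π ^ b)) :
    Fintype.card ι * b ≤ Fintype.card κ * (2 * a + Fintype.card ι * C) := by
  have hne : ∀ {c d}, Associated c (π ^ d) → c ≠ 0 := fun h h0 => by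
    rw [h0] at h
    exact pow_ne_zero _ hπ.ne_zero ((associated_zero_iff_eq_zero _).mp h.symm)
  have hdeg : ∀ {α : Type} [Fintype α] [DecidableEq α] (M P Q : Matrix α α O) (s : α → ℕ) (d : ℕ),
      IsUnit P.det → IsUnit Q.det → M = P * Matrix.diagonal (fun i => π ^ s i) * Q →
      Associated M.det (π ^ d) → ∑ i, s i = d := by
    intro α _ _ M P Q s d hP hQ hM hd
    rw [hM, Matrix.det_mul, Matrix.det_mul, Matrix.det_diagonal, Finset.prod_pow_eq_pow_sum] at hd
    have h1 : Associated (π ^ ∑ i, s i) (π ^ d) :=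
      ((associated_mul_unit_left _ _ hQ).trans (associated_unit_mul_left _ _ hP)).symm.trans hd
    exact le_antisymm ((pow_dvd_pow_iff hπ.ne_zero hπ.not_isUnit).mp h1.dvd)
      ((pow_dvd_pow_iff hπ.ne_zero hπ.not_isUnit).mp h1.dvd')
  obtain ⟨P, Q, t, hP, hQ, hTP⟩ := T.exists_eq_mul_diagonal_pow_mul hπ (hne hT)
  obtain ⟨P', Q', u, hP', hQ', hUP⟩ := U.exists_eq_mul_diagonal_pow_mul hπ (hne hU)
  rw [← hdeg T P Q t a hP hQ hTP hT, ← hdeg U P' Q' u b hP' hQ' hUP hU]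
  refine card_mul_sum_exponents_le hπ N hsmall hn hN
    ((B.compl₁₂ P.mulVecLin P.mulVecLin).compr₂ (P'⁻¹).mulVecLin) (fun x y => ?_) C
    (fun x hx j => ?_) t u fun j l i => ?_
  · simp [hB (P *ᵥ x)]
  · have h1 := hC (P *ᵥ x) (fun i => by
      have := Matrix.dvd_mulVec P' hx i
      simpa [Matrix.mulVec_mulVec, Matrix.mul_nonsing_inv _ hP'] using this)
    have := Matrix.dvd_mulVec P⁻¹ h1 j
    simpa [Matrix.mulVec_mulVec, Matrix.nonsing_inv_mul _ hP] using this
  · have h1 : ∀ j, T *ᵥ (Q⁻¹ *ᵥ Pi.single j 1) = π ^ t j • (P *ᵥ Pi.single j 1) := by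
      intro j
      rw [hTP, Matrix.mulVec_mulVec, Matrix.mul_assoc, Matrix.mul_nonsing_inv _ hQ, Matrix.mul_one,
        ← Matrix.mulVec_mulVec, ← Matrix.mulVec_smul]
      congr 1
      rw [Matrix.diagonal_mulVec_single, ← Pi.single_smul, smul_eq_mul]
    have h2 := hTU (Q⁻¹ *ᵥ Pi.single j 1) (Q⁻¹ *ᵥ Pi.single l 1)
    rw [h1, h1, map_smul, map_smul, LinearMap.smul_apply, smul_smul] at h2
    have h3 := congrArg (fun v => (P'⁻¹ *ᵥ v) i) h2
    simp only [Matrix.mulVec_smul, Pi.smul_apply, smul_eq_mul] at h3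
    rw [hUP, Matrix.mulVec_mulVec, ← Matrix.mul_assoc, ← Matrix.mul_assoc,
      Matrix.nonsing_inv_mul _ hP', Matrix.one_mul, ← Matrix.mulVec_mulVec,
      Matrix.mulVec_diagonal] at h3
    simp only [LinearMap.compr₂_apply, LinearMap.compl₁₂_apply, Matrix.mulVecLin_apply]
    refine ⟨_, Eq.trans ?_ h3⟩
    ring

open scoped Matrix in
/-- Systems of `r` quadratic forms in more than `4 r` variables over a discrete valuation ring
with large finite residue field have nontrivial zeros. -/
theorem exists_zero_of_four_mul_card_lt {O k : Type*} [CommRing O] [IsDomain O]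
    [IsDiscreteValuationRing O] [Field k] [Fintype k] {π : O} (hπ : Irreducible π)
    (φ : O →+* k) (hsurj : Function.Surjective φ) (hφ : ∀ a, φ a = 0 ↔ π ∣ a) (h2 : (2 : k) ≠ 0)
    (hcomp : ∀ (ι κ : Type) [Fintype ι] [Fintype κ]
      (B : (ι → O) →ₗ[O] (ι → O) →ₗ[O] (κ → O)), (∀ x, B x x = 0 → x = 0) →
        ∃ C : ℕ, ∀ x, (∀ i, π ^ C ∣ B x x i) → ∀ j, π ∣ x j)
    (N : ℕ) (hq : 4 * (1 + (N + 1) * (N * (N + 1) + 1) ^ N) ^ 2 ≤ Fintype.card k)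
    (ι κ : Type) [Fintype ι] [Fintype κ] (hn : 4 * Fintype.card κ < Fintype.card ι)
    (hN : Fintype.card ι ≤ N) (B : (ι → O) →ₗ[O] (ι → O) →ₗ[O] (κ → O))
    (hB : ∀ x y, B x y = B y x) : ∃ x ≠ 0, B x x = 0 := by
  classical
  induction hr : Fintype.card κ using Nat.strong_induction_on generalizing ι κ with
  | _ r ih =>
  have hsmall : ∀ (ι' κ' : Type) [Fintype ι'] [Fintype κ'], Fintype.card κ' < Fintype.card κ →
      4 * Fintype.card κ' < Fintype.card ι' → Fintype.card ι' ≤ N →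
      ∀ B : (ι' → O) →ₗ[O] (ι' → O) →ₗ[O] (κ' → O), (∀ x y, B x y = B y x) →
        ∃ x ≠ 0, B x x = 0 := fun ι' κ' _ _ h1 h2 h3 B' hB' =>
    ih _ (hr ▸ h1) ι' κ' h2 h3 B' hB' rfl
  have hloc : IsLocalHom φ := ⟨fun a ha => by
    by_contra h
    rw [← mem_nonunits_iff, ← IsLocalRing.mem_maximalIdeal,
      (IsDiscreteValuationRing.irreducible_iff_uniformizer π).mp hπ,
      Ideal.mem_span_singleton, ← hφ] at h
    exact ha.ne_zero h⟩
  by_contra! hani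
  replace hani : ∀ x, B x x = 0 → x = 0 := fun x hx => by
    by_contra h
    exact hani x h hx
  have hι : 0 < Fintype.card ι := by omega
  have hκ : Nonempty κ := by
    by_contra h
    rw [not_nonempty_iff] at h
    have : Nonempty ι := Fintype.card_pos_iff.mp hι
    have h1 := hani 1 (Subsingleton.elim _ _)
    exact one_ne_zero (congrFun h1 (Classical.arbitrary ι))
  obtain ⟨C, hC⟩ := hcomp ι κ B hani
  have hbound := card_mul_exponent_det_le hπ N hsmall hn hN B hB C hC
  let Data : ℕ → ℕ → Matrix ι ι O → Matrix κ κ O →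
      ((ι → O) →ₗ[O] (ι → O) →ₗ[O] (κ → O)) → Prop := fun a b T U B' =>
    (∀ x y, B' x y = B' y x) ∧ (∀ x y, B (T *ᵥ x) (T *ᵥ y) = U *ᵥ B' x y) ∧
      Associated T.det (π ^ a) ∧ Associated U.det (π ^ b)
  have hex : ∃ m a b T U B', Data a b T U B' ∧
      m + Fintype.card ι * b = Fintype.card κ * (2 * a + Fintype.card ι * C) :=
    ⟨_, 0, 0, 1, 1, B, ⟨hB, by simp, by simp, by simp⟩, by rw [mul_zero, add_zero]⟩
  obtain ⟨a, b, T, U, B', ⟨hB', hTU, hT, hU⟩, hm⟩ := Nat.find_spec hex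
  have hmin : ∀ (W : Submodule k (ι → k)) (C' : Submodule k (κ → k)),
      (∀ c ∈ C', ∀ x y : ι → O, φ ∘ x ∈ W → φ ∘ y ∈ W → c ⬝ᵥ (φ ∘ B' x y) = 0) →
      Fintype.card ι * Module.finrank k C' + 2 * Fintype.card κ * Module.finrank k W ≤
        2 * Fintype.card κ * Fintype.card ι := by
    intro W C' hCW
    obtain ⟨T₁, U₁, B₁, hB₁, hTU₁, hT₁, hU₁⟩ :=
      exists_transform_of_isotropic φ hsurj hπ.ne_zero hφ B' hB' W C' hCW
    have hTT := hT.mul_mul hT₁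
    have hUU := hU.mul_mul hU₁
    rw [← Matrix.det_mul, ← pow_add] at hTT hUU
    have hD : ∀ x y, B ((T * T₁) *ᵥ x) ((T * T₁) *ᵥ y) = (U * U₁) *ᵥ B₁ x y := fun x y => by
      rw [← Matrix.mulVec_mulVec, ← Matrix.mulVec_mulVec, hTU, hTU₁, Matrix.mulVec_mulVec]
    have h1 := hbound _ _ B₁ hD _ _ hTT hUU
    obtain ⟨m', hm'⟩ := Nat.exists_eq_add_of_le' h1
    have h2 := Nat.find_min' hex ⟨_, _, _, _, _, ⟨hB₁, hD, hTT, hUU⟩, hm'.symm⟩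
    have h3 : Module.finrank k W ≤ Fintype.card ι := by
      simpa using Submodule.finrank_le W
    obtain ⟨w, hw⟩ := Nat.exists_eq_add_of_le h3
    have hw' : Fintype.card ι - Module.finrank k W = w := by omega
    rw [hw'] at hm'
    generalize Nat.find hex = m at hm h2
    have h4 := congrArg (Fintype.card κ * ·) hw
    simp only [mul_add] at h4 hm hm'
    linarith
  have hani' : ∀ x, B' x x = 0 → x = 0 := fun x hx => by
    have h1 := hani (T *ᵥ x) (by rw [hTU, hx, Matrix.mulVec_zero])
    refine Matrix.eq_zero_of_mulVec_eq_zero (fun h0 => ?_) h1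
    rw [h0] at hT
    exact pow_ne_zero _ hπ.ne_zero ((associated_zero_iff_eq_zero _).mp hT.symm)
  obtain ⟨C', hC'⟩ := hcomp ι κ B' hani'
  obtain ⟨Bk, hBk⟩ := B'.exists_map_bilin φ
  have hlift : ∀ {α : Type} (x : α → k), ∃ y : α → O, φ ∘ y = x := fun x =>
    ⟨_, (Function.surjInv_eq hsurj <| x ·) |> funext⟩
  obtain ⟨x, hx0, hxns⟩ := exists_nonsingular_zero h2 Bk (fun x y => by
      obtain ⟨x, rfl⟩ := hlift x
      obtain ⟨y, rfl⟩ := hlift y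
      rw [hBk, hBk, hB'])
    (fun C' W hCW => by
      rw [Module.finrank_fintype_fun_eq_card]
      exact hmin W C' fun c hc x y hx hy => by
        rw [← hBk]
        exact hCW c hc _ hx _ hy)
    (by rwa [Module.finrank_fintype_fun_eq_card]) N (by rwa [Module.finrank_fintype_fun_eq_card]) hq
  obtain ⟨x, rfl⟩ := hlift x
  have hns : ∀ z : κ → k, ∃ y, φ ∘ B' x y = z := by
    intro z
    obtain ⟨y, hy⟩ := LinearMap.surjective_of_dotProduct_ne_zero (Bk (φ ∘ x)) hxns z
    obtain ⟨y, rfl⟩ := hlift y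
    exact ⟨y, by rw [← hBk, hy]⟩
  obtain ⟨y, hyx, hy⟩ := exists_lift_zero_mod_pow φ hφ h2 B' hB' x (fun i => by
    rw [← hφ]
    rw [hBk] at hx0
    exact congrFun hx0 i) hns C'
  have h1 := hC' y fun i => (pow_dvd_pow π (Nat.le_succ C')).trans (hy i)
  have h3 : φ ∘ x = 0 := funext fun j => (hφ _).mpr ((dvd_sub_right (h1 j)).mp (hyx j))
  obtain ⟨z, hz⟩ := hxns 1 one_ne_zero
  rw [h3] at hz
  simp at hz

/-- By compactness, an anisotropic system of quadratic forms does not represent zero primitively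
modulo high powers of the uniformizer. -/
theorem exists_forall_pow_dvd_imp_dvd {O k : Type*} [CommRing O] [IsDomain O]
    [IsDiscreteValuationRing O] [TopologicalSpace O] [IsTopologicalRing O] [CompactSpace O]
    [T2Space O] [Field k] [Finite k] {π : O} (hπ : Irreducible π) (φ : O →+* k)
    (hφ : ∀ a, φ a = 0 ↔ π ∣ a) {ι κ : Type*} [Finite ι] [Finite κ]
    (B : (ι → O) →ₗ[O] (ι → O) →ₗ[O] (κ → O)) (hB : ∀ x, B x x = 0 → x = 0) :
    ∃ C : ℕ, ∀ x, (∀ i, π ^ C ∣ B x x i) → ∀ j, π ∣ x j := by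
  classical
  have := Fintype.ofFinite ι
  have hclosed : ∀ a : O, IsClosed {x : O | a ∣ x} := by
    intro a
    have : {x : O | a ∣ x} = Set.range fun y => a * y := by
      ext x
      exact ⟨fun ⟨y, hy⟩ => ⟨y, hy.symm⟩, fun ⟨y, hy⟩ => ⟨y, hy.symm⟩⟩
    rw [this]
    exact (isCompact_range (continuous_const.mul continuous_id)).isClosed
  have hopen : IsOpen {x : O | π ∣ x} := by
    have h1 : {x : O | π ∣ x} = φ.toAddMonoidHom.ker := by
      ext x
      exact (hφ x).symm
    have : φ.toAddMonoidHom.ker.FiniteIndex := by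
      have : Finite φ.toAddMonoidHom.range := Subtype.finite
      infer_instance
    rw [h1]
    exact AddSubgroup.isOpen_of_isClosed_of_finiteIndex _ (h1 ▸ hclosed π)
  have hcont : ∀ i, Continuous fun x : ι → O => B x x i := by
    intro i
    have h1 : (fun x : ι → O => B x x i) = fun x => ∑ j, ∑ l, (x j * x l) •
        B (Pi.single j 1) (Pi.single l 1) i := by
      funext x
      rw [LinearMap.apply_apply_eq_sum_single B]
      simp only [Finset.sum_apply, Pi.smul_apply]
    rw [h1]
    fun_prop
  by_contra! hcon
  let S : ℕ → Set (ι → O) := fun C => {x | (∀ i, π ^ C ∣ B x x i) ∧ ∃ j, ¬ π ∣ x j}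
  have hScl : ∀ C, IsClosed (S C) := by
    intro C
    have h1 : S C = (⋂ i, (fun x : ι → O => B x x i) ⁻¹' {x | π ^ C ∣ x}) ∩
        ⋃ j, (fun x : ι → O => x j) ⁻¹' {x | π ∣ x}ᶜ := by
      ext x
      simp [S]
    rw [h1]
    refine (isClosed_iInter fun i => (hclosed _).preimage (hcont i)).inter
      (isClosed_iUnion_of_finite fun j => hopen.isClosed_compl.preimage (continuous_apply j))
  obtain ⟨x, hx⟩ := IsCompact.nonempty_iInter_of_sequence_nonempty_isCompact_isClosed S
    (fun C x hx => ⟨fun i => (pow_dvd_pow π C.le_succ).trans (hx.1 i), hx.2⟩) hcon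
    (hScl 0).isCompact hScl
  rw [Set.mem_iInter] at hx
  obtain ⟨j, hj⟩ := (hx 0).2
  have h0 : x = 0 := by
    refine hB x (funext fun i => ?_)
    by_contra h
    obtain ⟨n, hn⟩ := FiniteMultiplicity.of_not_isUnit hπ.not_isUnit h
    exact hn ((hx (n + 1)).1 i)
  exact hj (by simp [h0])

open Polynomial in
theorem ZMod.exists_monic_irreducible_natDegree_eq (p : ℕ) [Fact p.Prime] {m : ℕ} (hm : m ≠ 0) :
    ∃ f : (ZMod p)[X], f.Monic ∧ Irreducible f ∧ f.natDegree = m := by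
  obtain ⟨α, hα⟩ := Field.exists_primitive_element (ZMod p) (GaloisField p m)
  have hy_int : IsIntegral (ZMod p) α := IsIntegral.of_finite _ _
  refine ⟨minpoly (ZMod p) α, minpoly.monic hy_int, minpoly.irreducible hy_int, ?_⟩
  rw [(Field.primitive_element_iff_minpoly_natDegree_eq (ZMod p) α).mp hα, GaloisField.finrank p hm]

open Polynomial in
theorem PadicInt.exists_monic_irreducible_map_natDegree_eq (p : ℕ) [Fact p.Prime] {m : ℕ}
    (hm : m ≠ 0) : ∃ f : ℤ_[p][X], f.Monic ∧ Irreducible (f.map PadicInt.toZMod) ∧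
      f.natDegree = m := by
  obtain ⟨g, hg, hirr, hgm⟩ := ZMod.exists_monic_irreducible_natDegree_eq p hm
  have hlift : g ∈ lifts (PadicInt.toZMod (p := p)) := by
    rw [lifts_iff_coeff_lifts]
    exact fun n => ZMod.ringHom_surjective _ _
  obtain ⟨f, hf, hdeg, hfm⟩ := lifts_and_natDegree_eq_and_monic hlift hg
  exact ⟨f, hfm, hf ▸ hirr, hdeg.trans hgm⟩

theorem PadicInt.toZMod_eq_zero_iff {p : ℕ} [Fact p.Prime] (a : ℤ_[p]) :
    PadicInt.toZMod a = 0 ↔ (p : ℤ_[p]) ∣ a := by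
  rw [← RingHom.mem_ker, PadicInt.ker_toZMod, PadicInt.maximalIdeal_eq_span_p,
    Ideal.mem_span_singleton]

open Polynomial in
/-- The unramified extension of `ℤ_p` defined by a lift of an irreducible polynomial, together
with its reduction map. -/
theorem PadicInt.isDiscreteValuationRing_adjoinRoot {p : ℕ} [Fact p.Prime] {f : ℤ_[p][X]}
    (hf : f.Monic) (hirr : Irreducible (f.map (PadicInt.toZMod (p := p)))) :
    ∃ (_ : IsDomain (AdjoinRoot f)) (_ : IsDiscreteValuationRing (AdjoinRoot f))
      (φ : AdjoinRoot f →+* AdjoinRoot (f.map (PadicInt.toZMod (p := p)))),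
      Irreducible (p : AdjoinRoot f) ∧ Function.Surjective φ ∧
        ∀ a, φ a = 0 ↔ (p : AdjoinRoot f) ∣ a := by
  have hfirr : Irreducible f := hf.irreducible_of_irreducible_map _ _ hirr
  have hdom : IsDomain (AdjoinRoot f) := AdjoinRoot.isDomain_of_prime hfirr.prime
  have := Fact.mk hirr
  let ψ := PadicInt.toZMod (p := p)
  have hψs : Function.Surjective ψ := ZMod.ringHom_surjective _
  let φ : AdjoinRoot f →+* AdjoinRoot (f.map ψ) :=
    AdjoinRoot.lift ((AdjoinRoot.of (f.map ψ)).comp ψ) (AdjoinRoot.root (f.map ψ)) (by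
      rw [← eval₂_map, AdjoinRoot.eval₂_root])
  have hφmk : ∀ g : ℤ_[p][X], φ (AdjoinRoot.mk f g) = AdjoinRoot.mk (f.map ψ) (g.map ψ) := by
    intro g
    simp only [φ, AdjoinRoot.lift_mk]
    rw [← eval₂_map, ← AdjoinRoot.aeval_eq]
    rfl
  have hφs : Function.Surjective φ := by
    intro b
    obtain ⟨b, rfl⟩ := AdjoinRoot.mk_surjective b
    obtain ⟨g, rfl⟩ := map_surjective ψ hψs b
    exact ⟨_, hφmk g⟩
  have hφ : ∀ a, φ a = 0 ↔ (p : AdjoinRoot f) ∣ a := by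
    intro a
    constructor
    · intro ha
      obtain ⟨g, rfl⟩ := AdjoinRoot.mk_surjective a
      rw [hφmk, AdjoinRoot.mk_eq_zero] at ha
      obtain ⟨h, hh⟩ := ha
      obtain ⟨h, rfl⟩ := map_surjective ψ hψs h
      rw [← Polynomial.map_mul, ← sub_eq_zero, ← Polynomial.map_sub] at hh
      have hdvd : C (p : ℤ_[p]) ∣ g - f * h := by
        rw [C_dvd_iff_dvd_coeff]
        intro i
        rw [← PadicInt.toZMod_eq_zero_iff, ← coeff_map, hh, coeff_zero]
      obtain ⟨d, hd⟩ := hdvd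
      refine ⟨AdjoinRoot.mk f d, ?_⟩
      have h1 : AdjoinRoot.mk f (g - f * h) = AdjoinRoot.mk f g := by simp
      rw [← h1, hd, map_mul]
      simp
    · rintro ⟨b, rfl⟩
      have h0 : φ p = 0 := by
        rw [map_natCast]
        have : ((p : ZMod p) : ZMod p) = 0 := by simp
        rw [← map_natCast (AdjoinRoot.of (f.map ψ)), this, map_zero]
      rw [map_mul, h0, zero_mul]
  have hker : RingHom.ker φ = Ideal.span {(p : AdjoinRoot f)} := by
    ext a
    rw [RingHom.mem_ker, hφ, Ideal.mem_span_singleton]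
  have hmax : (Ideal.span {(p : AdjoinRoot f)}).IsMaximal := by
    rw [← hker]
    exact RingHom.ker_isMaximal_of_surjective φ hφs
  have hfin : Module.Finite ℤ_[p] (AdjoinRoot f) := hf.finite_adjoinRoot
  have hloc : IsLocalRing (AdjoinRoot f) := by
    refine IsLocalRing.of_unique_max_ideal ⟨_, hmax, fun I hI => ?_⟩
    have h1 : (I.comap (algebraMap ℤ_[p] (AdjoinRoot f))).IsMaximal :=
      Ideal.isMaximal_comap_of_isIntegral_of_isMaximal I
    have h2 := IsLocalRing.eq_maximalIdeal h1
    have h3 : (p : ℤ_[p]) ∈ I.comap (algebraMap ℤ_[p] (AdjoinRoot f)) := by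
      rw [h2, PadicInt.maximalIdeal_eq_span_p]
      exact Ideal.mem_span_singleton_self _
    rw [Ideal.mem_comap, map_natCast] at h3
    refine (hmax.eq_of_le hI.ne_top ?_).symm
    rwa [Ideal.span_singleton_le_iff_mem]
  have hp0 : (p : AdjoinRoot f) ≠ 0 := by
    intro h0
    have h1 : AdjoinRoot.mk f (p : ℤ_[p][X]) = 0 := by simpa using h0
    rw [AdjoinRoot.mk_eq_zero] at h1
    have h2 : f.natDegree = 0 := by
      have := natDegree_le_of_dvd h1 (by exact_mod_cast (Fact.out : p.Prime).ne_zero)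
      simpa using this
    have h3 := hirr.natDegree_pos
    rw [hf.natDegree_map] at h3
    omega
  have hnoeth : IsNoetherianRing (AdjoinRoot f) := IsNoetherianRing.of_finite ℤ_[p] _
  have hmaxeq : IsLocalRing.maximalIdeal (AdjoinRoot f) = Ideal.span {(p : AdjoinRoot f)} :=
    (IsLocalRing.eq_maximalIdeal hmax).symm
  have hnf : ¬ IsField (AdjoinRoot f) := by
    rw [IsLocalRing.isField_iff_maximalIdeal_eq, hmaxeq, Ideal.span_singleton_eq_bot]
    exact hp0
  have hdvr : IsDiscreteValuationRing (AdjoinRoot f) := by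
    rw [((IsDiscreteValuationRing.TFAE (AdjoinRoot f) hnf).out 0 4 :)]
    exact ⟨⟨_, hmaxeq⟩⟩
  exact ⟨hdom, hdvr, φ, (IsDiscreteValuationRing.irreducible_iff_uniformizer _).mpr hmaxeq, hφs, hφ⟩

theorem exists_compact_t2_isTopologicalRing (R A : Type*) [CommRing R] [TopologicalSpace R]
    [IsTopologicalRing R] [CompactSpace R] [T2Space R] [CommRing A] [Algebra R A]
    [Module.Finite R A] [Module.Free R A] :
    ∃ (_ : TopologicalSpace A), IsTopologicalRing A ∧ CompactSpace A ∧ T2Space A := by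
  let : TopologicalSpace A := moduleTopology R A
  have : IsModuleTopology R A := ⟨rfl⟩
  have : IsTopologicalRing A := IsModuleTopology.isTopologicalRing R A
  have : ContinuousSMul R A := IsModuleTopology.toContinuousSMul R A
  let e := (Module.Free.chooseBasis R A).equivFun
  have h1 : Continuous e := IsModuleTopology.continuous_of_linearMap e.toLinearMap
  have h2 : Continuous e.symm := IsModuleTopology.continuous_of_linearMap e.symm.toLinearMap
  refine ⟨inferInstance, inferInstance, ?_, ?_⟩
  · exact e.symm.surjective.compactSpace h2
  · exact T2Space.of_injective_continuous e.injective h1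

open Polynomial in
/-- Systems of quadratic forms over `ℤ_p` in more than four times as many variables have
nontrivial zeros modulo a suitable irreducible polynomial of odd degree. -/
theorem PadicInt.exists_dvd_quadraticForm (p : ℕ) [Fact p.Prime] (hp : p ≠ 2) (N M : ℕ) :
    ∃ f : ℤ_[p][X], f.Monic ∧ Odd f.natDegree ∧ f.natDegree.Prime ∧ M < f.natDegree ∧
      Irreducible (f.map (PadicInt.toZMod (p := p))) ∧
      ∀ (ι κ : Type) [Fintype ι] [Fintype κ], 4 * Fintype.card κ < Fintype.card ι →
        Fintype.card ι ≤ N → ∀ w : ι → ι → κ → ℤ_[p], (∀ j l, w j l = w l j) →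
          ∃ g : ι → ℤ_[p][X], (∀ j, (g j).natDegree < f.natDegree) ∧ (∃ j, g j ≠ 0) ∧
            ∀ i, f ∣ ∑ j, ∑ l, C (w j l i) * (g j * g l) := by
  classical
  have hpp : p.Prime := Fact.out
  obtain ⟨Q, hQ⟩ : ∃ Q, Q = 4 * (1 + (N + 1) * (N * (N + 1) + 1) ^ N) ^ 2 := ⟨_, rfl⟩
  obtain ⟨m, hm, hmp⟩ := Nat.exists_infinite_primes (M + Q + 3)
  obtain ⟨f, hf, hirr, hfm⟩ := PadicInt.exists_monic_irreducible_map_natDegree_eq p hmp.ne_zero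
  refine ⟨f, hf, ?_, by rwa [hfm], by omega, hirr, ?_⟩
  · rw [hfm]; exact hmp.odd_of_ne_two (by omega)
  intro ι κ _ _ hn hN w hw
  obtain ⟨_, _, φ, hπ, hφs, hφ⟩ := PadicInt.isDiscreteValuationRing_adjoinRoot hf hirr
  have := Fact.mk hirr
  have hfin : Module.Finite ℤ_[p] (AdjoinRoot f) := hf.finite_adjoinRoot
  have hfree : Module.Free ℤ_[p] (AdjoinRoot f) := hf.free_adjoinRoot
  obtain ⟨_, _, _, _⟩ := exists_compact_t2_isTopologicalRing ℤ_[p] (AdjoinRoot f)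
  let k := AdjoinRoot (f.map (PadicInt.toZMod (p := p)))
  let pb := AdjoinRoot.powerBasis hirr.ne_zero
  have : Module.Finite (ZMod p) k := pb.finite
  have : Finite k := Module.finite_of_finite (ZMod p)
  let _ : Fintype k := Fintype.ofFinite k
  have hcard : Fintype.card k = p ^ m := by
    rw [Module.card_fintype pb.basis, ZMod.card, Fintype.card_fin, AdjoinRoot.powerBasis_dim,
      hf.natDegree_map, hfm]
  have h2 : (2 : k) ≠ 0 := by
    have h1 : (2 : ZMod p) ≠ 0 := by
      intro h
      have : ((2 : ℕ) : ZMod p) = 0 := by exact_mod_cast h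
      rw [ZMod.natCast_eq_zero_iff] at this
      exact hp ((Nat.prime_dvd_prime_iff_eq hpp Nat.prime_two).mp this)
    intro h
    refine h1 ((AdjoinRoot.of (f.map (PadicInt.toZMod (p := p)))).injective ?_)
    rw [map_zero, map_ofNat]
    exact h
  obtain ⟨B, hB⟩ := LinearMap.exists_apply_single_eq (R := AdjoinRoot f)
    fun j l : ι => fun i : κ => algebraMap ℤ_[p] (AdjoinRoot f) (w j l i)
  have hBB : ∀ x y, B x y = ∑ j, ∑ l, (x j * y l) •
      fun i : κ => algebraMap ℤ_[p] (AdjoinRoot f) (w j l i) := fun x y => by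
    rw [LinearMap.apply_apply_eq_sum_single]
    simp only [hB]
  obtain ⟨x, hx0, hx⟩ := exists_zero_of_four_mul_card_lt hπ φ hφs hφ h2
    (fun ι κ _ _ B hB => exists_forall_pow_dvd_imp_dvd hπ φ hφ B hB) N (by
      rw [hcard, ← hQ]
      have h3 := Nat.lt_pow_self hpp.one_lt (n := m)
      omega) ι κ hn hN B (fun x y => by
        rw [hBB, hBB, Finset.sum_comm]
        refine Finset.sum_congr rfl fun j _ => Finset.sum_congr rfl fun l _ => ?_
        rw [hw, mul_comm])
  have hf1 : f ≠ 1 := by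
    rintro rfl
    rw [natDegree_one] at hfm
    exact hmp.ne_zero hfm.symm
  have hrep : ∀ j, ∃ g : ℤ_[p][X], g.natDegree < f.natDegree ∧ AdjoinRoot.mk f g = x j := by
    intro j
    obtain ⟨g, hg⟩ := AdjoinRoot.mk_surjective (x j)
    refine ⟨g %ₘ f, natDegree_modByMonic_lt g hf hf1, ?_⟩
    rw [← hg, AdjoinRoot.mk_eq_mk]
    rw [modByMonic_eq_sub_mul_div]
    simp
  choose g hg hgx using hrep
  refine ⟨g, hg, ?_, fun i => ?_⟩
  · by_contra! h
    refine hx0 (funext fun j => ?_)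
    rw [← hgx, h j, map_zero, Pi.zero_apply]
  · rw [← AdjoinRoot.mk_eq_zero]
    have h3 := congrFun hx i
    rw [hBB] at h3
    simp only [Finset.sum_apply, Pi.smul_apply, smul_eq_mul, Pi.zero_apply] at h3
    rw [← h3]
    simp only [map_sum, map_mul, hgx, AdjoinRoot.mk_C, AdjoinRoot.algebraMap_eq]
    exact Finset.sum_congr rfl fun j _ => Finset.sum_congr rfl fun l _ => mul_comm _ _

open Polynomial in
theorem Irreducible.map_of_finrank_lt_prime {E F : Type*} [Field E] [Field F] [Algebra E F]
    [FiniteDimensional E F] {f : E[X]} (hf : Irreducible f) (hp : f.natDegree.Prime)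
    (hlt : Module.finrank E F < f.natDegree) : Irreducible (f.map (algebraMap E F)) := by
  have hdeg : (f.map (algebraMap E F)).natDegree = f.natDegree := natDegree_map _
  have h0 : f.map (algebraMap E F) ≠ 0 := by
    rw [Polynomial.map_ne_zero_iff (algebraMap E F).injective]
    exact hf.ne_zero
  obtain ⟨g, hg, hgf⟩ := WfDvdMonoid.exists_irreducible_factor (a := f.map (algebraMap E F))
    (fun hu => by
      have := natDegree_eq_zero_of_isUnit hu
      rw [hdeg] at this
      exact hp.ne_zero this) h0
  have := Fact.mk hg
  let pb := AdjoinRoot.powerBasis hg.ne_zero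
  have : Module.Finite F (AdjoinRoot g) := pb.finite
  have hgd : Module.finrank F (AdjoinRoot g) = g.natDegree := by
    rw [pb.finrank, AdjoinRoot.powerBasis_dim]
  have : FiniteDimensional E (AdjoinRoot g) := FiniteDimensional.trans E F (AdjoinRoot g)
  have hroot : aeval (AdjoinRoot.root g) f = 0 := by
    rw [← aeval_map_algebraMap F, AdjoinRoot.aeval_eq, AdjoinRoot.mk_eq_zero]
    exact hgf
  have hmin := minpoly.eq_of_irreducible hf hroot
  have hmd : (minpoly E (AdjoinRoot.root g)).natDegree = f.natDegree := by
    rw [← hmin, natDegree_mul_C (inv_ne_zero (leadingCoeff_ne_zero.mpr hf.ne_zero))]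
  have hdvd : f.natDegree ∣ Module.finrank E F * g.natDegree := by
    rw [← hgd, Module.finrank_mul_finrank, ← hmd]
    exact minpoly.degree_dvd (IsIntegral.of_finite _ _)
  have h1 : f.natDegree ∣ g.natDegree := by
    refine (hp.dvd_mul.mp hdvd).resolve_left fun h => ?_
    exact absurd (Nat.le_of_dvd Module.finrank_pos h) (by omega)
  have h2 : (f.map (algebraMap E F)).natDegree ≤ g.natDegree := by
    rw [hdeg]; exact Nat.le_of_dvd hg.natDegree_pos h1
  exact (associated_of_dvd_of_natDegree_le hgf h0 h2).irreducible hg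

open Polynomial in
/-- A quadratic form over a field whose values on the span of a finite family `v` of large size are
combinations of a smaller family `u` with `p`-adically integral coefficients is isotropic. -/
theorem exists_zero_of_structure_constants (p : ℕ) [Fact p.Prime] {F : Type}
    [Field F] (h2 : (2 : F) ≠ 0) (σ : ℤ_[p] →+* F) {ι α β : Type} [Fintype ι] [Fintype α]
    [Fintype β]
    (q : ι → ι → F) (hqs : ∀ i j, q i j = q j i) (v : α → F) (u : β → F)
    (hv : ∀ a : α → ℤ_[p], ∑ s, σ (a s) * v s = 0 → a = 0)
    (c : ι → ι → α → α → β → ℤ_[p])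
    (hc : ∀ i j s s', q i j * (v s * v s') = ∑ t, σ (c i j s s' t) * u t)
    (f : ℤ_[p][X]) (hf : f.Monic) (hodd : Odd f.natDegree) (hirr : Irreducible (f.map σ))
    (hzero : ∀ w : ι × α → ι × α → β → ℤ_[p], (∀ j l, w j l = w l j) →
          ∃ g : ι × α → ℤ_[p][X], (∀ j, (g j).natDegree < f.natDegree) ∧ (∃ j, g j ≠ 0) ∧
            ∀ i, f ∣ ∑ j, ∑ l, C (w j l i) * (g j * g l)) :
    ∃ x : ι → F, x ≠ 0 ∧ ∑ i, ∑ j, q i j * (x i * x j) = 0 := by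
  by_contra! hani
  obtain ⟨g, hgdeg, ⟨⟨i₀, s₀⟩, hg0⟩, hg⟩ := hzero
    (fun a b t => c a.1 b.1 a.2 b.2 t + c b.1 a.1 b.2 a.2 t)
    (fun a b => funext fun t => add_comm _ _)
  let G : ι → F[X] := fun i => ∑ s, C (v s) * (g (i, s)).map σ
  have hterm : ∀ i j s s',
      C (2 * q i j) * (C (v s) * (g (i, s)).map σ * (C (v s') * (g (j, s')).map σ)) =
      ∑ t, C (u t) * (C (c i j s s' t + c j i s' s t) * (g (i, s) * g (j, s'))).map σ := by
    intro i j s s'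
    have h1 : 2 * q i j * (v s * v s') = ∑ t, σ (c i j s s' t + c j i s' s t) * u t := by
      simp only [map_add, add_mul, Finset.sum_add_distrib, ← hc]
      rw [hqs j i]; ring
    have h3 := congrArg (C (R := F)) h1
    simp only [map_sum, map_mul] at h3
    simp only [Polynomial.map_mul, map_C]
    calc _ = (C 2 * C (q i j) * (C (v s) * C (v s'))) * ((g (i, s)).map σ * (g (j, s')).map σ) := by
          rw [C_mul]; ring
      _ = _ := by
          rw [h3, Finset.sum_mul]
          exact Finset.sum_congr rfl fun t _ => by ring
  have hdvd : f.map σ ∣ ∑ i, ∑ j, C (2 * q i j) * (G i * G j) := by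
    have h1 : ∑ i, ∑ j, C (2 * q i j) * (G i * G j) = ∑ t, C (u t) *
        (∑ a : ι × α, ∑ b : ι × α, C (c a.1 b.1 a.2 b.2 t + c b.1 a.1 b.2 a.2 t) *
          (g a * g b)).map σ := by
      have h3 : ∑ i, ∑ j, C (2 * q i j) * (G i * G j) = ∑ a : ι × α, ∑ b : ι × α,
          ∑ t, C (u t) * (C (c a.1 b.1 a.2 b.2 t + c b.1 a.1 b.2 a.2 t) * (g a * g b)).map σ := by
        have hGG : ∀ i j, C (2 * q i j) * (G i * G j) = ∑ s, ∑ s', ∑ t,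
            C (u t) * (C (c i j s s' t + c j i s' s t) * (g (i, s) * g (j, s'))).map σ := by
          intro i j
          simp only [← hterm]
          simp only [G, Finset.sum_mul_sum]
          simp only [Finset.mul_sum]
        simp only [hGG]
        rw [Fintype.sum_prod_type]
        refine Finset.sum_congr rfl fun i _ => ?_
        simp only [Fintype.sum_prod_type]
        rw [Finset.sum_comm]
      rw [h3]
      simp only [Polynomial.map_sum, Finset.mul_sum]
      symm
      rw [Finset.sum_comm]
      refine Finset.sum_congr rfl fun a _ => ?_
      rw [Finset.sum_comm]
    rw [h1]
    exact Finset.dvd_sum fun t _ => (Polynomial.map_dvd σ (hg t)).mul_left _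
  have hG := springer_odd_degree (fun i j => 2 * q i j) (fun x hx => by
      by_contra h0
      refine hani x h0 ?_
      simp only [mul_assoc, ← Finset.mul_sum] at hx
      exact (mul_eq_zero.mp hx).resolve_left h2) (f.map σ) hirr
    (by rwa [hf.natDegree_map]) G hdvd
  have hG0 : G i₀ = 0 := by
    refine eq_zero_of_dvd_of_natDegree_lt (hG i₀) ?_
    rw [hf.natDegree_map]
    refine (natDegree_sum_le_of_forall_le _ _ (n := f.natDegree - 1) fun s _ => ?_).trans_lt
      (Nat.sub_lt hodd.pos one_pos)
    refine (natDegree_C_mul_le _ _).trans (natDegree_map_le.trans ?_)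
    have := hgdeg (i₀, s)
    omega
  refine hg0 (Polynomial.ext fun n => ?_)
  have h1 := hv (fun s => (g (i₀, s)).coeff n) (by
    have := congrArg (coeff · n) hG0
    simp only [G, finsetSum_coeff, coeff_C_mul, coeff_map, coeff_zero] at this
    rw [← this]
    exact Finset.sum_congr rfl fun s _ => mul_comm _ _)
  exact congrFun h1 s₀

open Polynomial in
/-- Over a finite extension of a rational function field, the coefficients of powers of the
variable in the values of a quadratic form of dimension at least nine form a system of quadratic
forms in more than four times as many unknown coefficients. -/
theorem exists_structure_constants {A E F : Type} [CommRing A] [IsDomain A] [Field E]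
    [Algebra A[X] E] [IsFractionRing A[X] E] [Field F] [Algebra E F] [FiniteDimensional E F]
    {ι : Type} [Fintype ι] (hι : 9 ≤ Fintype.card ι) (q : ι → ι → F) (σ : A →+* F)
    (hσ : σ = ((algebraMap E F).comp (algebraMap A[X] E)).comp C) :
    ∃ (α β : Type) (_ : Fintype α) (_ : Fintype β) (v : α → F) (u : β → F) (h : F)
      (c : ι → ι → α → α → β → A), h ≠ 0 ∧ (∀ a : α → A, ∑ s, σ (a s) * v s = 0 → a = 0) ∧
      (∀ i j s s', h * q i j * (v s * v s') = ∑ t, σ (c i j s s' t) * u t) ∧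
      4 * Fintype.card β < Fintype.card (ι × α) := by
  classical
  let ev : A[X] →+* F := (algebraMap E F).comp (algebraMap A[X] E)
  have hevσ : ∀ a, ev (C a) = σ a := fun a => by rw [hσ]; rfl
  let b := Module.finBasis E F
  let M := Module.finrank E F
  have hM : 0 < M := Module.finrank_pos
  obtain ⟨h, hh⟩ := IsLocalization.exist_integer_multiples_of_finite (nonZeroDivisors A[X])
    fun z : ι × ι × Fin M × Fin M × Fin M =>
      b.repr (q z.1 z.2.1 * (b z.2.2.1 * b z.2.2.2.1)) z.2.2.2.2
  choose H hH using hh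
  obtain ⟨δ, hδ⟩ : ∃ δ, ∀ z, (H z).natDegree ≤ δ :=
    ⟨Finset.univ.sup fun z => (H z).natDegree, fun z =>
      Finset.le_sup (f := fun z => (H z).natDegree) (Finset.mem_univ z)⟩
  let D := 4 * δ + 1
  let x : F := ev X
  have hev : ∀ (P : A[X]) (m : ℕ), P.natDegree < m →
      ev P = ∑ a : Fin m, σ (P.coeff a) * x ^ (a : ℕ) := by
    intro P m hP
    conv_lhs => rw [P.as_sum_range_C_mul_X_pow' hP]
    rw [map_sum, Finset.sum_range]
    refine Finset.sum_congr rfl fun a _ => ?_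
    rw [map_mul, map_pow, hevσ]
  refine ⟨Fin M × Fin D, Fin M × Fin (2 * D + δ), inferInstance, inferInstance,
    fun s => b s.1 * x ^ (s.2 : ℕ), fun t => b t.1 * x ^ (t.2 : ℕ), ev h,
    fun i j s s' t => (X ^ ((s.2 : ℕ) + s'.2) * H (i, j, s.1, s'.1, t.1)).coeff t.2,
    ?_, ?_, ?_, ?_⟩
  · intro h0
    have h1 := (map_eq_zero_iff _ (algebraMap E F).injective).mp h0
    exact nonZeroDivisors.coe_ne_zero h ((map_eq_zero_iff _ (IsFractionRing.injective A[X] E)).mp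
      h1)
  · intro y hy
    let P : Fin M → A[X] := fun j => ∑ a : Fin D, C (y (j, a)) * X ^ (a : ℕ)
    have h1 : ∑ j, algebraMap A[X] E (P j) • b j = 0 := by
      rw [← hy, Fintype.sum_prod_type]
      refine Finset.sum_congr rfl fun j _ => ?_
      have h2 : algebraMap A[X] E (P j) • b j = ev (P j) * b j := Algebra.smul_def _ _
      rw [h2]
      simp only [P, map_sum, map_mul, map_pow, hevσ, Finset.sum_mul]
      exact Finset.sum_congr rfl fun a _ => by ring
    ext ⟨j, a⟩
    have h2 := Fintype.linearIndependent_iff.mp b.linearIndependent _ h1 j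
    have h3 := (map_eq_zero_iff _ (IsFractionRing.injective A[X] E)).mp h2
    have h4 := congrArg (coeff · (a : ℕ)) h3
    simpa [P, finsetSum_coeff, coeff_C_mul, coeff_X_pow, Fin.val_inj] using h4
  · intro i j s s'
    have h1 : ev h * (q i j * (b s.1 * b s'.1)) =
        ∑ l, ev (H (i, j, s.1, s'.1, l)) * b l := by
      conv_lhs => rw [← b.sum_repr (q i j * (b s.1 * b s'.1)), Finset.mul_sum]
      refine Finset.sum_congr rfl fun l _ => ?_
      have h2 := congrArg (algebraMap E F) (hH (i, j, s.1, s'.1, l))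
      simp only [Algebra.smul_def, map_mul] at h2 ⊢
      change ev _ = ev _ * _ at h2
      rw [h2, mul_assoc]
    calc _ = x ^ ((s.2 : ℕ) + s'.2) * (ev h * (q i j * (b s.1 * b s'.1))) := by ring
      _ = ∑ l, ev (X ^ ((s.2 : ℕ) + s'.2) * H (i, j, s.1, s'.1, l)) * b l := by
          rw [h1, Finset.mul_sum]
          exact Finset.sum_congr rfl fun l _ => by rw [map_mul, map_pow, mul_assoc]
      _ = _ := by
          rw [Fintype.sum_prod_type]
          refine Finset.sum_congr rfl fun l _ => ?_
          rw [hev _ (2 * D + δ) ?_, Finset.sum_mul]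
          · exact Finset.sum_congr rfl fun a _ => by ring
          · refine natDegree_mul_le.trans_lt ?_
            have h2 := hδ (i, j, s.1, s'.1, l)
            have h3 := s.2.isLt
            have h4 := s'.2.isLt
            rw [natDegree_X_pow]
            omega
  · simp only [Fintype.card_prod, Fintype.card_fin]
    have : 9 * (M * D) ≤ Fintype.card ι * (M * D) := Nat.mul_le_mul_right _ hι
    refine lt_of_lt_of_le ?_ this
    simp only [D]
    nlinarith

theorem IsAlgebraic.subfield_of_range_subset {A F : Type} [Field A] [Field F] [Algebra A F]
    {T : Subfield F} (hT : ∀ a, algebraMap A F a ∈ T) {y : F} (hy : IsAlgebraic A y) :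
    IsAlgebraic T y := by
  obtain ⟨f, hf0, hf⟩ := hy
  let j : A →+* T := (algebraMap A F).codRestrict T hT
  refine ⟨f.map j, (Polynomial.map_ne_zero_iff j.injective).2 hf0, ?_⟩
  rw [Polynomial.aeval_def, Polynomial.eval₂_map]
  exact hf

theorem Subfield.eq_top_of_isAlgebraic_mem {K F : Type} [Field K] [Field F] [Algebra K F] {x : F}
    [FiniteDimensional (IntermediateField.adjoin K {x}) F] {T : Subfield F}
    (hK : ∀ a, algebraMap K F a ∈ T) (hx : x ∈ T) (hT : ∀ y, IsAlgebraic T y → y ∈ T) :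
    T = ⊤ := by
  let T' : IntermediateField K F := T.toIntermediateField hK
  have hle : IntermediateField.adjoin K {x} ≤ T' :=
    IntermediateField.adjoin_le_iff.2 (Set.singleton_subset_iff.2 hx)
  refine top_le_iff.1 fun y _ => hT y ?_
  exact IsAlgebraic.subfield_of_range_subset (A := IntermediateField.adjoin K {x})
    (fun a => hle a.2) (Algebra.IsAlgebraic.isAlgebraic y)

open Polynomial in
/-- A field essentially of finite type over a domain `R` which is algebraic over the subfield
generated by `R` and a transcendental element is finite over the fraction field of `R[X]`. -/
theorem exists_finiteDimensional_fractionRing {R F : Type} [CommRing R] [IsDomain R] [Field F]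
    [Algebra R F] [Algebra.EssFiniteType R F] {x : F} (hx : Transcendental R x)
    (halg : ∀ T : Subfield F, (∀ r, algebraMap R F r ∈ T) → x ∈ T →
      (∀ y, IsAlgebraic T y → y ∈ T) → T = ⊤) :
    ∃ _ : Algebra (FractionRing R[X]) F, FiniteDimensional (FractionRing R[X]) F ∧
      ∀ r : R, algebraMap (FractionRing R[X]) F (algebraMap R[X] _ (C r)) = algebraMap R F r := by
  have hinj : Function.Injective (aeval x : R[X] →ₐ[R] F).toRingHom :=
    transcendental_iff_injective.1 hx
  let φ : FractionRing R[X] →+* F := IsFractionRing.lift hinj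
  let := φ.toAlgebra
  have hφ : ∀ f : R[X], φ (algebraMap R[X] _ f) = aeval x f :=
    fun f => IsFractionRing.lift_algebraMap hinj f
  have hC : ∀ r : R, φ (algebraMap R[X] _ (C r)) = algebraMap R F r := fun r => by
    rw [hφ, aeval_C]
  refine ⟨this, ?_, hC⟩
  have : IsScalarTower R (FractionRing R[X]) F := IsScalarTower.of_algebraMap_eq fun r => by
    rw [IsScalarTower.algebraMap_apply R R[X] (FractionRing R[X])]
    exact (hC r).symm
  have : Algebra.EssFiniteType (FractionRing R[X]) F :=
    Algebra.EssFiniteType.of_comp R (FractionRing R[X]) F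
  let T := algebraicClosure (FractionRing R[X]) F
  have htop : T.toSubfield = ⊤ := by
    refine halg _ (fun r => ?_) ?_ fun y hy => ?_
    · rw [← hC r]
      exact T.algebraMap_mem _
    · have : φ (algebraMap R[X] _ X) = x := by rw [hφ, aeval_X]
      rw [← this]
      exact T.algebraMap_mem _
    · have : IsAlgebraic T y := hy
      exact (mem_algebraicClosure_iff).2 (this.restrictScalars (FractionRing R[X]))
  have hy_int : ∀ y : F, IsIntegral (FractionRing R[X]) y := fun y => by
    have : y ∈ T.toSubfield := htop ▸ Subfield.mem_top y
    exact ((mem_algebraicClosure_iff).1 this).isIntegral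
  obtain ⟨s, hs⟩ := IntermediateField.fg_top (FractionRing R[X]) F
  have hfin := IntermediateField.finiteDimensional_adjoin (K := FractionRing R[X])
    (S := (s : Set F)) fun y _ => hy_int y
  rw [hs] at hfin
  let e := IntermediateField.topEquiv (F := FractionRing R[X]) (E := F)
  exact e.toLinearEquiv.finiteDimensional

theorem essFiniteType_of_finiteDimensional_adjoin {K F : Type} [Field K] [Field F] [Algebra K F]
    (x : F) [FiniteDimensional (IntermediateField.adjoin K {x}) F] : Algebra.EssFiniteType K F := by
  have : Algebra.EssFiniteType K (IntermediateField.adjoin K {x}) :=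
    IntermediateField.essFiniteType_iff.2 ⟨{x}, by simp⟩
  exact Algebra.EssFiniteType.comp K (IntermediateField.adjoin K {x}) F

open Polynomial in
theorem irreducible_map_algebraMap_comp_C (p : ℕ) [Fact p.Prime] {E F : Type} [Field E]
    [Algebra ℤ_[p][X] E] [IsFractionRing ℤ_[p][X] E] [Field F] [Algebra E F]
    [FiniteDimensional E F] {f : ℤ_[p][X]} (hf : f.Monic) (hp : f.natDegree.Prime)
    (hlt : Module.finrank E F < f.natDegree)
    (hirr : Irreducible (f.map (PadicInt.toZMod (p := p)))) :
    Irreducible (f.map (((algebraMap E F).comp (algebraMap ℤ_[p][X] E)).comp C)) := by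
  have hA : Irreducible (f.map (C : ℤ_[p] →+* ℤ_[p][X])) := by
    refine (hf.map C).irreducible_of_irreducible_map
      ((PadicInt.toZMod (p := p)).comp (evalRingHom 0)) _ ?_
    have he : ((PadicInt.toZMod (p := p)).comp (evalRingHom 0)).comp C = PadicInt.toZMod :=
      RingHom.ext fun r => by simp
    rw [Polynomial.map_map, he]
    exact hirr
  have hE := (Polynomial.Monic.irreducible_iff_irreducible_map_fraction_map (K := E)
    (hf.map C)).1 hA
  have hdeg : ((f.map (C : ℤ_[p] →+* ℤ_[p][X])).map (algebraMap ℤ_[p][X] E)).natDegree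
      = f.natDegree := by
    rw [(hf.map C).natDegree_map, hf.natDegree_map]
  have := hE.map_of_finrank_lt_prime (F := F) (by rw [hdeg]; exact hp) (by rw [hdeg]; exact hlt)
  rwa [Polynomial.map_map, Polynomial.map_map] at this

open Polynomial in
theorem exists_zero_of_nine_le_card (p : ℕ) [Fact p.Prime] (hp : p ≠ 2) {E F : Type} [Field E]
    [Algebra ℤ_[p][X] E] [IsFractionRing ℤ_[p][X] E] [Field F] [Algebra E F]
    [FiniteDimensional E F] (h2 : (2 : F) ≠ 0) {ι : Type} [Fintype ι] (hι : 9 ≤ Fintype.card ι)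
    (q : ι → ι → F) (hqs : ∀ i j, q i j = q j i) :
    ∃ x : ι → F, x ≠ 0 ∧ ∑ i, ∑ j, q i j * (x i * x j) = 0 := by
  obtain ⟨α, β, _, _, v, u, h, c, hh, hv, hc, hcard⟩ := exists_structure_constants hι q
    (((algebraMap E F).comp (algebraMap ℤ_[p][X] E)).comp C) rfl
  obtain ⟨f, hf, hodd, hprime, hlt, hirr, hzero⟩ := PadicInt.exists_dvd_quadraticForm p hp
    (Fintype.card (ι × α)) (Module.finrank E F)
  obtain ⟨x, hx, hx0⟩ := exists_zero_of_structure_constants p h2 _ (fun i j => h * q i j)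
    (fun i j => by rw [hqs]) v u hv c hc f hf hodd
    (irreducible_map_algebraMap_comp_C p hf hprime hlt hirr)
    fun w hw => hzero (ι × α) β hcard le_rfl w hw
  refine ⟨x, hx, (mul_eq_zero.1 (?_ : h * _ = 0)).resolve_left hh⟩
  rw [← hx0, Finset.mul_sum]
  refine Finset.sum_congr rfl fun i _ => ?_
  rw [Finset.mul_sum]
  exact Finset.sum_congr rfl fun j _ => (mul_assoc _ _ _).symm

theorem QuadraticForm.not_anisotropic_of_nine_le {p : ℕ} [Fact p.Prime] (hp : p ≠ 2)
    {K : Type} [Field K] [Algebra ℚ_[p] K] [FiniteDimensional ℚ_[p] K]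
    {F : Type} [Field F] [Algebra K F] {x : F} (hx : Transcendental K x)
    [FiniteDimensional (IntermediateField.adjoin K {x}) F] {m : ℕ} (hm : 9 ≤ m)
    (Q : QuadraticForm F (Fin m → F)) : ¬ Q.Anisotropic := by
  let : Algebra ℤ_[p] K := ((algebraMap ℚ_[p] K).comp (algebraMap ℤ_[p] ℚ_[p])).toAlgebra
  have : IsScalarTower ℤ_[p] ℚ_[p] K := IsScalarTower.of_algebraMap_eq fun _ => rfl
  let : Algebra ℤ_[p] F := ((algebraMap K F).comp (algebraMap ℤ_[p] K)).toAlgebra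
  have : IsScalarTower ℤ_[p] K F := IsScalarTower.of_algebraMap_eq fun _ => rfl
  have : Algebra.EssFiniteType ℤ_[p] ℚ_[p] :=
    Algebra.EssFiniteType.of_isLocalization _ (nonZeroDivisors ℤ_[p])
  have : Algebra.EssFiniteType ℤ_[p] K := Algebra.EssFiniteType.comp ℤ_[p] ℚ_[p] K
  have : Algebra.EssFiniteType K F := essFiniteType_of_finiteDimensional_adjoin x
  have : Algebra.EssFiniteType ℤ_[p] F := Algebra.EssFiniteType.comp ℤ_[p] K F
  have hK : Function.Injective (algebraMap ℤ_[p] K) :=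
    (algebraMap ℚ_[p] K).injective.comp (IsFractionRing.injective ℤ_[p] ℚ_[p])
  have hx' : Transcendental ℤ_[p] x := fun ⟨f, hf0, hf⟩ =>
    hx ⟨f.map (algebraMap ℤ_[p] K), (Polynomial.map_ne_zero_iff hK).2 hf0, by
      rwa [Polynomial.aeval_map_algebraMap]⟩
  have h2 : (2 : F) ≠ 0 := by
    have : (algebraMap K F).comp (algebraMap ℚ_[p] K) 2 ≠ 0 :=
      (map_ne_zero _).2 two_ne_zero
    rwa [map_ofNat] at this
  obtain ⟨_, _, -⟩ := exists_finiteDimensional_fractionRing hx' fun T hR hxT hT => by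
    refine Subfield.eq_top_of_isAlgebraic_mem (K := K) (x := x) (fun a => hT _ ?_) hxT hT
    let : Algebra ℚ_[p] F := ((algebraMap K F).comp (algebraMap ℚ_[p] K)).toAlgebra
    have : IsScalarTower ℚ_[p] K F := IsScalarTower.of_algebraMap_eq fun _ => rfl
    refine IsAlgebraic.subfield_of_range_subset (A := ℚ_[p]) (fun b => ?_)
      ((Algebra.IsAlgebraic.isAlgebraic a).algebraMap)
    obtain ⟨r, s, hs, rfl⟩ := IsFractionRing.div_surjective (A := ℤ_[p]) b
    rw [map_div₀]
    exact div_mem (hR r) (hR s)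
  intro hQ
  let : Invertible (2 : F) := invertibleOfNonzero h2
  obtain ⟨y, hy, hy0⟩ := exists_zero_of_nine_le_card p hp h2 (ι := Fin m) (by simpa using hm)
    (E := FractionRing (Polynomial ℤ_[p]))
    (fun i j => QuadraticMap.associated Q (Pi.single i 1) (Pi.single j 1))
    (fun i j => QuadraticMap.associated_isSymm F Q _ _)
  refine hy (hQ y ?_)
  rw [← QuadraticMap.associated_eq_self_apply F Q y, ← hy0,
    ← LinearMap.sum_repr_mul_repr_mul (Pi.basisFun F (Fin m)) (Pi.basisFun F (Fin m))]
  rw [Finsupp.sum_fintype _ _ fun i => by simp]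
  refine Finset.sum_congr rfl fun i _ => ?_
  rw [Finsupp.sum_fintype _ _ fun j => by simp]
  refine Finset.sum_congr rfl fun j _ => ?_
  rw [Pi.basisFun_repr, Pi.basisFun_repr, Pi.basisFun_apply, Pi.basisFun_apply, smul_eq_mul,
    smul_eq_mul]
  ring

theorem HasAnisotropicDiagonal.exists_quadraticForm {F ι : Type} [Field F] [Fintype ι]
    (h : HasAnisotropicDiagonal F ι) {m : ℕ} (hm : Fintype.card ι = m) :
    ∃ Q : QuadraticForm F (Fin m → F), Q.Anisotropic := by
  obtain ⟨a, ha⟩ := h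
  let e : ι ≃ Fin m := Fintype.equivFinOfCardEq hm
  refine ⟨QuadraticMap.weightedSumSquares F (fun i => a (e.symm i)), fun x hx => ?_⟩
  have : (fun i => x (e i)) = 0 := by
    refine ha _ ?_
    rw [← hx, QuadraticMap.weightedSumSquares_apply, ← e.sum_comp]
    exact Finset.sum_congr rfl fun i _ => by simp [pow_two]
  ext i
  simpa using congrFun this (e.symm i)

theorem uInv_eq_eight_of_padic_functionField
    (p : ℕ) [Fact p.Prime] (hp : p ≠ 2)
    (K : Type) [Field K] [Algebra ℚ_[p] K] [FiniteDimensional ℚ_[p] K]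
    (F : Type) [Field F] [Algebra K F] (hF : IsOneVarFunctionField K F) :
    uInv F = 8 := by
  obtain ⟨x, hx, _⟩ := hF
  refine le_antisymm (sSup_le ?_) (le_sSup ⟨8, rfl, ?_⟩)
  · rintro _ ⟨m, rfl, Q, hQ⟩
    by_contra hm
    have h8 : 9 ≤ m := by
      have := not_le.1 hm
      exact_mod_cast this
    exact QuadraticForm.not_anisotropic_of_nine_le hp hx h8 Q hQ
  · have := essFiniteType_of_finiteDimensional_adjoin (K := K) x
    obtain ⟨_, _, -⟩ := exists_finiteDimensional_fractionRing hx fun T hK hxT hT =>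
      Subfield.eq_top_of_isAlgebraic_mem hK hxT hT
    exact (hasAnisotropicDiagonal_of_functionField p hp K
      (FractionRing (Polynomial K)) F).exists_quadraticForm rfl
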